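/- Let n ≥ 4 with n ≡ 1 (mod 3). A matrix A ∈ 𝒜(n,3) achieves the maximal permanent among matrices in 𝒜(n,3) if and only if its rows and columns can be permuted to yield (J_4 − I_4) ⊕ J_3 ⊕ ⋯ ⊕ J_3, with (n−4)/3 copies of J_3. -/

import Mathlib

open scoped BigOperators

namespace BGM

/-- The permanent of a square matrix with natural number entries. -/
def perm {n : ℕ} (M : Matrix (Fin n) (Fin n) ℕ) : ℕ :=
  ∑ φ : Equiv.Perm (Fin n), ∏ i, M i (φ i)

/-- `M` is a (0,1)-matrix. -/
def IsZeroOne {n : ℕ} (M : Matrix (Fin n) (Fin n) ℕ) : Prop :=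
  ∀ i j, M i j = 0 ∨ M i j = 1

/-- The number of entries of `M` equal to `0`. -/
def zeroCount {n : ℕ} (M : Matrix (Fin n) (Fin n) ℕ) : ℕ :=
  (Finset.univ.filter fun p : Fin n × Fin n => M p.1 p.2 = 0).card

/-- `𝒰(n, τ)`: the n×n (0,1)-matrices with exactly τ zero entries. -/
def Uclass (n τ : ℕ) : Set (Matrix (Fin n) (Fin n) ℕ) :=
  {M | IsZeroOne M ∧ zeroCount M = τ}

/-- `μ(n, τ) = max {per A : A ∈ 𝒰(n, τ)}`. -/
noncomputable def mu (n τ : ℕ) : ℕ :=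
  sSup (perm '' Uclass n τ)

/-- `𝒜(n, k)`: the n×n (0,1)-matrices with exactly k ones in each row and column. -/
def Aclass (n k : ℕ) : Set (Matrix (Fin n) (Fin n) ℕ) :=
  {M | IsZeroOne M ∧ (∀ i, ∑ j, M i j = k) ∧ (∀ j, ∑ i, M i j = k)}

/-- `P` is a permutation matrix. -/
def IsPermMatrix {n : ℕ} (P : Matrix (Fin n) (Fin n) ℕ) : Prop :=
  ∃ e : Equiv.Perm (Fin n), ∀ i j, P i j = if j = e i then 1 else 0

/-- `A` and `B` are combinatorially equivalent: `B = PAQ` or `B = PAᵀQ` for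
permutation matrices `P`, `Q`. -/
def CombEquiv {n : ℕ} (A B : Matrix (Fin n) (Fin n) ℕ) : Prop :=
  ∃ P Q, IsPermMatrix P ∧ IsPermMatrix Q ∧ (B = P * A * Q ∨ B = P * A.transpose * Q)

/-- Index of the block (of consecutive sizes `L`) containing position `i`. -/
def blockIdx : List ℕ → ℕ → ℕ
  | [], _ => 0
  | s :: L, i => if i < s then 0 else blockIdx L (i - s) + 1

/-- The n×n block-diagonal direct sum of all-ones blocks of sizes `L`
(with `L.sum = n`). -/
def listBlocks (n : ℕ) (L : List ℕ) : Matrix (Fin n) (Fin n) ℕ :=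
  Matrix.of fun i j => if blockIdx L (i : ℕ) = blockIdx L (j : ℕ) then 1 else 0

/-- The n×n block-diagonal matrix with a head block `B` (of size `m`) followed by
all-ones blocks of sizes `L` (with `m + L.sum = n`). -/
def headBlocks (n : ℕ) {m : ℕ} (B : Matrix (Fin m) (Fin m) ℕ) (L : List ℕ) :
    Matrix (Fin n) (Fin n) ℕ :=
  Matrix.of fun i j =>
    if h : (i : ℕ) < m ∧ (j : ℕ) < m then B ⟨(i : ℕ), h.1⟩ ⟨(j : ℕ), h.2⟩
    else if m ≤ (i : ℕ) ∧ m ≤ (j : ℕ) ∧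
        blockIdx L ((i : ℕ) - m) = blockIdx L ((j : ℕ) - m) then 1 else 0

/-- `M` with the `(i0, j0)` entry changed to `1`. -/
def setOne {n : ℕ} (M : Matrix (Fin n) (Fin n) ℕ) (i0 j0 : Fin n) :
    Matrix (Fin n) (Fin n) ℕ :=
  Matrix.of fun i j => if i = i0 ∧ j = j0 then 1 else M i j

/-- `J₃ - I₃`. -/
def J3mI3 : Matrix (Fin 3) (Fin 3) ℕ := Matrix.of fun i j => if i = j then 0 else 1

/-- `J₄ - I₄`. -/
def J4mI4 : Matrix (Fin 4) (Fin 4) ℕ := Matrix.of fun i j => if i = j then 0 else 1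

/-- `A₃`: the 3×3 all-ones matrix except the (1,1) entry is 0. -/
def A3 : Matrix (Fin 3) (Fin 3) ℕ := Matrix.of fun i j => if i = 0 ∧ j = 0 then 0 else 1

/-- `A₃ ⊕ I₂`. -/
def V5 : Matrix (Fin 5) (Fin 5) ℕ :=
  !![0,1,1,0,0; 1,1,1,0,0; 1,1,1,0,0; 0,0,0,1,0; 0,0,0,0,1]

/-- `J₃ ⊕ I₂`. -/
def S5 : Matrix (Fin 5) (Fin 5) ℕ :=
  !![1,1,1,0,0; 1,1,1,0,0; 1,1,1,0,0; 0,0,0,1,0; 0,0,0,0,1]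

/-- The head block of `W`. -/
def BW : Matrix (Fin 4) (Fin 4) ℕ :=
  !![0,0,1,1; 1,1,0,1; 1,1,1,0; 1,1,0,1]

/-- The head block of `X`. -/
def BX : Matrix (Fin 4) (Fin 4) ℕ :=
  !![0,0,1,1; 1,0,1,1; 1,1,0,1; 1,1,1,0]

/-- The head block of `Y`. -/
def BY : Matrix (Fin 4) (Fin 4) ℕ :=
  !![0,0,1,1; 1,0,1,1; 1,1,0,0; 1,1,1,1]

/-- `A₃ ⊕ I₁`. -/
def T4 : Matrix (Fin 4) (Fin 4) ℕ :=
  !![0,1,1,0; 1,1,1,0; 1,1,1,0; 0,0,0,1]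

/-- `A₄ ⊕ J₂`, where `A₄` is `J₄` with the (1,1) entry changed to 0. -/
def Q6 : Matrix (Fin 6) (Fin 6) ℕ :=
  !![0,1,1,1,0,0; 1,1,1,1,0,0; 1,1,1,1,0,0; 1,1,1,1,0,0; 0,0,0,0,1,1; 0,0,0,0,1,1]

/-- `J₃ ⊕ I₁`. -/
def M4 : Matrix (Fin 4) (Fin 4) ℕ :=
  !![1,1,1,0; 1,1,1,0; 1,1,1,0; 0,0,0,1]


set_option linter.unusedSectionVars false

section Match

variable {V : Type} [Fintype V] [DecidableEq V]

/-- The number of perfect matchings of the subgraph induced on `S`, matchings being encoded as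
involutions. -/
def pmc (N : V → Finset V) (S : Finset V) : ℕ :=
  (Finset.univ.filter fun σ : Equiv.Perm V =>
    (∀ v, σ (σ v) = v) ∧ (∀ v ∈ S, σ v ∈ N v) ∧ ∀ v, v ∉ S → σ v = v).card

/-- The product of the degrees in the subgraph induced on `S`. -/
def dprod (N : V → Finset V) (S : Finset V) : ℕ := ∏ v ∈ S, (N v ∩ S).card

/-- A bipartite graph given by its neighbourhoods. -/
structure BGraph (N : V → Finset V) (col : V → Bool) : Prop where
  symm : ∀ u v, u ∈ N v → v ∈ N u
  bip : ∀ u v, u ∈ N v → col u = !col v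

theorem BGraph.irrefl {N : V → Finset V} {col : V → Bool} (hG : BGraph N col) (v : V) :
    v ∉ N v := by
  intro h
  have := hG.bip v v h
  cases h' : col v <;> simp [h'] at this

theorem pmc_expand {N : V → Finset V} {col : V → Bool} (hG : BGraph N col) {S : Finset V} {v : V}
    (hv : v ∈ S) : pmc N S = ∑ u ∈ N v ∩ S, pmc N (S \ {v, u}) := by
  classical
  unfold pmc
  rw [Finset.card_eq_sum_card_fiberwise (f := fun σ : Equiv.Perm V => σ v) (t := N v ∩ S)]
  · refine Finset.sum_congr rfl fun u hu => ?_
    rw [Finset.mem_inter] at hu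
    obtain ⟨hu1, hu2⟩ := hu
    have huv : u ≠ v := by rintro rfl; exact hG.irrefl _ hu1
    refine Finset.card_bij' (fun σ _ => σ * Equiv.swap v u) (fun σ _ => σ * Equiv.swap v u)
      ?_ ?_ ?_ ?_
    · intro σ hσ
      simp only [Finset.mem_filter, Finset.mem_univ, true_and] at hσ ⊢
      obtain ⟨⟨h1, h2, h3⟩, h4⟩ := hσ
      have h5 : σ u = v := by rw [← h4, h1]
      have key : ∀ w, w ≠ v → w ≠ u → (σ * Equiv.swap v u) w = σ w := by
        intro w hw1 hw2
        simp [Equiv.swap_apply_of_ne_of_ne hw1 hw2]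
      have kv : (σ * Equiv.swap v u) v = v := by simp [h5]
      have ku : (σ * Equiv.swap v u) u = u := by simp [h4]
      refine ⟨fun w => ?_, fun w hw => ?_, fun w hw => ?_⟩
      · by_cases hw1 : w = v
        · rw [hw1, kv, kv]
        by_cases hw2 : w = u
        · rw [hw2, ku, ku]
        rw [key w hw1 hw2, key, h1]
        · intro h; apply hw2; rw [← h1 w, h, h4]
        · intro h; apply hw1; rw [← h1 w, h, h5]
      · simp only [Finset.mem_sdiff, Finset.mem_insert, Finset.mem_singleton, not_or] at hw
        rw [key w hw.2.1 hw.2.2]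
        exact h2 w hw.1
      · by_cases hw1 : w = v
        · rw [hw1, kv]
        by_cases hw2 : w = u
        · rw [hw2, ku]
        rw [key w hw1 hw2]
        apply h3
        intro h
        apply hw
        simp [h, hw1, hw2]
    · intro σ hσ
      simp only [Finset.mem_filter, Finset.mem_univ, true_and] at hσ ⊢
      obtain ⟨h1, h2, h3⟩ := hσ
      have h4 : σ v = v := h3 v (by simp)
      have h5 : σ u = u := h3 u (by simp)
      have key : ∀ w, w ≠ v → w ≠ u → (σ * Equiv.swap v u) w = σ w := by
        intro w hw1 hw2
        simp [Equiv.swap_apply_of_ne_of_ne hw1 hw2]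
      have kv : (σ * Equiv.swap v u) v = u := by simp [h5]
      have ku : (σ * Equiv.swap v u) u = v := by simp [h4]
      refine ⟨⟨fun w => ?_, fun w hw => ?_, fun w hw => ?_⟩, kv⟩
      · by_cases hw1 : w = v
        · rw [hw1, kv, ku]
        by_cases hw2 : w = u
        · rw [hw2, ku, kv]
        rw [key w hw1 hw2, key, h1]
        · intro h; apply hw1; rw [← h1 w, h, h4]
        · intro h; apply hw2; rw [← h1 w, h, h5]
      · by_cases hw1 : w = v
        · rw [hw1, kv]; exact hu1
        by_cases hw2 : w = u
        · rw [hw2, ku]; exact hG.symm _ _ hu1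
        rw [key w hw1 hw2]
        exact h2 w (by simp [hw, hw1, hw2])
      · have hw1 : w ≠ v := by rintro rfl; exact hw hv
        have hw2 : w ≠ u := by rintro rfl; exact hw hu2
        rw [key w hw1 hw2]
        apply h3
        simp [hw]
    · intro σ _
      simp [mul_assoc]
    · intro σ _
      simp [mul_assoc]
  · intro σ hσ
    simp only [Finset.coe_filter, Finset.mem_univ, true_and, Set.mem_ofPred_eq] at hσ
    obtain ⟨h1, h2, h3⟩ := hσ
    simp only [Finset.coe_inter, Set.mem_inter_iff, Finset.mem_coe]
    refine ⟨h2 v hv, ?_⟩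
    by_contra h
    have h4 := h3 _ h
    rw [h1] at h4
    have := h2 v hv
    rw [← h4] at this
    exact hG.irrefl _ this

theorem pmc_empty (N : V → Finset V) : pmc N ∅ = 1 := by
  unfold pmc
  rw [Finset.card_eq_one]
  refine ⟨1, ?_⟩
  ext σ
  simp only [Finset.mem_filter, Finset.mem_univ, true_and, Finset.mem_singleton]
  constructor
  · rintro ⟨_, _, h⟩
    ext w
    simp [h w]
  · rintro rfl
    simp

/-- Deleting a set `X` from a subcubic graph. -/
theorem dprod_sdiff {N : V → Finset V} {col : V → Bool} (hG : BGraph N col) {S X : Finset V}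
    (hX : X ⊆ S) (hd : ∀ v ∈ S, (N v ∩ S).card ≤ 3) :
    (dprod N (S \ X) : ℝ) * ∏ x ∈ X, ((N x ∩ S).card : ℝ) ≤
      dprod N S * (2 / 3 : ℝ) ^ (∑ x ∈ X, ((N x ∩ S).card - (N x ∩ X).card)) := by
  have h1 : ∑ x ∈ X, ((N x ∩ S).card - (N x ∩ X).card) = ∑ y ∈ S \ X, (N y ∩ X).card := by
    have : ∀ x ∈ X, (N x ∩ S).card - (N x ∩ X).card = ((S \ X).filter fun y => y ∈ N x).card := by
      intro x _
      have e : N x ∩ S = (N x ∩ X) ∪ ((S \ X).filter fun y => y ∈ N x) := by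
        ext y
        simp only [Finset.mem_inter, Finset.mem_union, Finset.mem_filter, Finset.mem_sdiff]
        have := @hX y
        tauto
      rw [e, Finset.card_union_of_disjoint]
      · simp
      · rw [Finset.disjoint_left]
        intro y
        simp only [Finset.mem_inter, Finset.mem_filter, Finset.mem_sdiff]
        tauto
    rw [Finset.sum_congr rfl this]
    refine (Finset.sum_card_bipartiteAbove_eq_sum_card_bipartiteBelow (s := X) (t := S \ X)
      (fun x y => y ∈ N x)).trans ?_
    refine Finset.sum_congr rfl fun y _ => ?_
    congr 1
    ext x
    simp only [Finset.bipartiteBelow, Finset.mem_inter, Finset.mem_filter]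
    constructor
    · rintro ⟨h, h'⟩; exact ⟨hG.symm _ _ h', h⟩
    · rintro ⟨h, h'⟩; exact ⟨h', hG.symm _ _ h⟩
  rw [h1]
  have h2 : dprod N S = (∏ y ∈ S \ X, (N y ∩ S).card) * ∏ x ∈ X, (N x ∩ S).card := by
    unfold dprod
    rw [Finset.prod_sdiff hX]
  rw [h2]
  push_cast
  rw [mul_right_comm]
  apply mul_le_mul_of_nonneg_right _ (by positivity)
  rw [← Finset.prod_pow_eq_pow_sum, ← Finset.prod_mul_distrib]
  unfold dprod
  push_cast
  refine Finset.prod_le_prod (fun _ _ => by positivity) fun y hy => ?_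
  have hyS : y ∈ S := (Finset.mem_sdiff.1 hy).1
  have e : (N y ∩ S).card = (N y ∩ (S \ X)).card + (N y ∩ X).card := by
    rw [← Finset.card_union_of_disjoint]
    · congr 1
      ext z
      simp only [Finset.mem_inter, Finset.mem_union, Finset.mem_sdiff]
      have := @hX z
      tauto
    · rw [Finset.disjoint_left]
      intro z
      simp only [Finset.mem_inter, Finset.mem_sdiff]
      tauto
  have h3 := hd y hyS
  rw [e] at h3 ⊢
  generalize (N y ∩ (S \ X)).card = p at *
  generalize (N y ∩ X).card = q at *
  have hp : p ≤ 3 := by omega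
  have hq : q ≤ 3 := by omega
  interval_cases p <;> interval_cases q <;> first | omega | norm_num

/-- A labelled set of vertices of `S` with known adjacencies. -/
structure Conf (N : V → Finset V) (S : Finset V) {ι : Type} (T : ι → ι → Bool) (f : ι → V) :
    Prop where
  inj : Function.Injective f
  mem : ∀ i, f i ∈ S
  adj : ∀ i j, f j ∈ N (f i) ↔ T i j = true

/-- Adjacency table from a biadjacency table. -/
def tb {p q : ℕ} (M : Fin p → Fin q → Bool) : Fin p ⊕ Fin q → Fin p ⊕ Fin q → Bool
  | Sum.inl i, Sum.inr j => M i j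
  | Sum.inr j, Sum.inl i => M i j
  | _, _ => false

theorem Conf.mk' {N : V → Finset V} {col : V → Bool} (hG : BGraph N col) {S : Finset V} {p q : ℕ}
    {M : Fin p → Fin q → Bool} {a : Fin p → V} {b : Fin q → V} (c : Bool)
    (ha : ∀ i, col (a i) = c) (hb : ∀ j, col (b j) = !c)
    (ia : Function.Injective a) (ib : Function.Injective b)
    (ma : ∀ i, a i ∈ S) (mb : ∀ j, b j ∈ S)
    (hM : ∀ i j, b j ∈ N (a i) ↔ M i j = true) : Conf N S (tb M) (Sum.elim a b) where
  inj := by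
    rintro (i | i) (j | j) h
    · simp only [Sum.elim_inl] at h; rw [ia h]
    · simp only [Sum.elim_inl, Sum.elim_inr] at h
      have h1 := ha i
      have h2 := hb j
      rw [h, h2] at h1
      cases c <;> simp at h1
    · simp only [Sum.elim_inl, Sum.elim_inr] at h
      have h1 := ha j
      have h2 := hb i
      rw [h, h1] at h2
      cases c <;> simp at h2
    · simp only [Sum.elim_inr] at h; rw [ib h]
  mem := by
    rintro (i | i)
    · exact ma i
    · exact mb i
  adj := by
    rintro (i | i) (j | j)
    · simp only [Sum.elim_inl, tb, Bool.false_eq_true, iff_false]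
      intro h
      have := hG.bip _ _ h
      rw [ha, ha] at this
      cases c <;> simp at this
    · exact hM i j
    · simp only [Sum.elim_inl, Sum.elim_inr, tb]
      rw [← hM j i]
      exact ⟨fun h => hG.symm _ _ h, fun h => hG.symm _ _ h⟩
    · simp only [Sum.elim_inr, tb, Bool.false_eq_true, iff_false]
      intro h
      have := hG.bip _ _ h
      rw [hb, hb] at this
      cases c <;> simp at this

section ConfLemmas

variable {N : V → Finset V} {col : V → Bool} {S : Finset V} {ι : Type} [Fintype ι] [DecidableEq ι]
  {T : ι → ι → Bool} {f : ι → V}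

/-- Number of matchings after deleting the vertices labelled by `I`. -/
def pq (N : V → Finset V) (S : Finset V) (f : ι → V) (I : Finset ι) : ℕ := pmc N (S \ I.image f)

theorem pq_empty : pq N S f ∅ = pmc N S := by simp [pq]

theorem Conf.expand (hG : BGraph N col) (hC : Conf N S T f) (I : Finset ι) (i : ι) (hi : i ∉ I)
    (hfull : (N (f i) ∩ S).card = (Finset.univ.filter fun j => T i j = true).card) :
    pq N S f I = ∑ j ∈ Finset.univ.filter (fun j => T i j = true ∧ j ∉ I),
      pq N S f (insert i (insert j I)) := by
  classical
  have h1 : N (f i) ∩ S = (Finset.univ.filter fun j => T i j = true).image f := by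
    symm
    apply Finset.eq_of_subset_of_card_le
    · intro y hy
      simp only [Finset.mem_image, Finset.mem_filter, Finset.mem_univ, true_and] at hy
      obtain ⟨j, hj, rfl⟩ := hy
      exact Finset.mem_inter.2 ⟨(hC.adj i j).2 hj, hC.mem j⟩
    · rw [Finset.card_image_of_injective _ hC.inj, hfull]
  have h2 : N (f i) ∩ (S \ I.image f) =
      (Finset.univ.filter (fun j => T i j = true ∧ j ∉ I)).image f := by
    rw [← Finset.inter_sdiff_assoc, h1]
    ext y
    simp only [Finset.mem_sdiff, Finset.mem_image, Finset.mem_filter, Finset.mem_univ, true_and]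
    constructor
    · rintro ⟨⟨j, hj, rfl⟩, h⟩
      exact ⟨j, ⟨hj, fun h' => h ⟨j, h', rfl⟩⟩, rfl⟩
    · rintro ⟨j, ⟨hj, hj'⟩, rfl⟩
      refine ⟨⟨j, hj, rfl⟩, ?_⟩
      rintro ⟨k, hk, e⟩
      rw [hC.inj e] at hk
      exact hj' hk
  have h3 : f i ∈ S \ I.image f := by
    simp only [Finset.mem_sdiff, Finset.mem_image, hC.mem i, true_and]
    rintro ⟨k, hk, e⟩
    rw [hC.inj e] at hk
    exact hi hk
  unfold pq
  rw [pmc_expand hG h3, h2, Finset.sum_image (fun _ _ _ _ h => hC.inj h)]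
  refine Finset.sum_congr rfl fun j _ => ?_
  congr 1
  ext y
  simp only [Finset.mem_sdiff, Finset.image_insert, Finset.mem_insert, Finset.mem_singleton]
  tauto

theorem Conf.dbound (hG : BGraph N col) (hC : Conf N S T f) (hd : ∀ v ∈ S, (N v ∩ S).card ≤ 3)
    (dg : ι → ℕ) (hdg : ∀ i, (N (f i) ∩ S).card = dg i) (hpos : ∀ i, 0 < dg i) (I : Finset ι)
    (E : ℕ) (hE : E ≤ ∑ i ∈ I, (dg i - (I.filter fun j => T i j = true).card))
    (D : ℕ) (hD : ∏ i ∈ I, dg i = D)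
    (c b : ℝ) (hb : (dprod N S : ℝ) = b ^ 4)
    (hc : (2 / 3 : ℝ) ^ E ≤ c ^ 4 * D) :
    (dprod N (S \ I.image f) : ℝ) ≤ (c * b) ^ 4 := by
  replace hD : (D : ℝ) = ∏ i ∈ I, (dg i : ℝ) := by rw [← hD]; push_cast; rfl
  rw [hD] at hc
  have hX : I.image f ⊆ S := by
    intro y hy
    obtain ⟨i, _, rfl⟩ := Finset.mem_image.1 hy
    exact hC.mem i
  have h := dprod_sdiff hG hX hd
  rw [Finset.prod_image (fun _ _ _ _ h => hC.inj h),
    Finset.sum_image (fun _ _ _ _ h => hC.inj h)] at h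
  have h2 : ∀ i, (N (f i) ∩ I.image f).card = (I.filter fun j => T i j = true).card := by
    intro i
    rw [← Finset.card_image_of_injective (I.filter fun j => T i j = true) hC.inj]
    congr 1
    ext y
    simp only [Finset.mem_inter, Finset.mem_image, Finset.mem_filter]
    constructor
    · rintro ⟨h, j, hj, rfl⟩
      exact ⟨j, ⟨hj, (hC.adj i j).1 h⟩, rfl⟩
    · rintro ⟨j, ⟨hj, hj'⟩, rfl⟩
      exact ⟨(hC.adj i j).2 hj', j, hj, rfl⟩
  simp only [h2, hdg] at h
  have hP : (0 : ℝ) < ∏ i ∈ I, (dg i : ℝ) := Finset.prod_pos fun i _ => by exact_mod_cast hpos i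
  refine le_of_mul_le_mul_right (h.trans ?_) hP
  rw [hb, mul_pow]
  have h3 : (2 / 3 : ℝ) ^ (∑ i ∈ I, (dg i - (I.filter fun j => T i j = true).card)) ≤
      (2 / 3 : ℝ) ^ E := pow_le_pow_of_le_one (by norm_num) (by norm_num) hE
  have h4 : (0 : ℝ) ≤ b ^ 4 := by positivity
  calc b ^ 4 * (2 / 3 : ℝ) ^ (∑ i ∈ I, (dg i - (I.filter fun j => T i j = true).card))
      ≤ b ^ 4 * (c ^ 4 * ∏ i ∈ I, (dg i : ℝ)) := by gcongr; exact h3.trans hc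
    _ = _ := by ring

theorem Conf.pbound (hG : BGraph N col) (hC : Conf N S T f) (hd : ∀ v ∈ S, (N v ∩ S).card ≤ 3)
    (ih : ∀ S' ⊂ S, (pmc N S') ^ 4 ≤ dprod N S')
    (dg : ι → ℕ) (hdg : ∀ i, (N (f i) ∩ S).card = dg i) (hpos : ∀ i, 0 < dg i) (I : Finset ι)
    (hI : I.Nonempty)
    (E : ℕ) (hE : E ≤ ∑ i ∈ I, (dg i - (I.filter fun j => T i j = true).card))
    (D : ℕ) (hD : ∏ i ∈ I, dg i = D)
    (c b : ℝ) (hb : (dprod N S : ℝ) = b ^ 4) (hb0 : 0 ≤ b) (hc0 : 0 ≤ c)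
    (hc : (2 / 3 : ℝ) ^ E ≤ c ^ 4 * D) :
    (pq N S f I : ℝ) ≤ c * b := by
  have h1 := hC.dbound hG hd dg hdg hpos I E hE D hD c b hb hc
  have h2 : S \ I.image f ⊂ S := by
    obtain ⟨i, hi⟩ := hI
    refine ⟨Finset.sdiff_subset, fun h => ?_⟩
    have := h (hC.mem i)
    simp only [Finset.mem_sdiff, Finset.mem_image] at this
    exact this.2 ⟨i, hi, rfl⟩
  have h3 : ((pmc N (S \ I.image f) : ℕ) : ℝ) ^ 4 ≤ dprod N (S \ I.image f) := by
    exact_mod_cast ih _ h2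
  exact le_of_pow_le_pow_left₀ (by norm_num) (by positivity) (h3.trans h1)

end ConfLemmas

section Steps

variable {N : V → Finset V} {col : V → Bool} {S : Finset V} {ι : Type} [Fintype ι] [DecidableEq ι]
  {T : ι → ι → Bool} {f : ι → V}

theorem Conf.ex1 (hG : BGraph N col) (hC : Conf N S T f) (I : Finset ι) (i j : ι) (I1 : Finset ι)
    (hfull : (N (f i) ∩ S).card = (Finset.univ.filter fun j => T i j = true).card)
    (h : i ∉ I ∧ (Finset.univ.filter (fun j => T i j = true ∧ j ∉ I)) = {j} ∧
      insert i (insert j I) = I1) : pq N S f I = pq N S f I1 := by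
  obtain ⟨hi, h1, h2⟩ := h
  rw [hC.expand hG I i hi hfull, h1, Finset.sum_singleton, h2]

theorem Conf.ex2 (hG : BGraph N col) (hC : Conf N S T f) (I : Finset ι) (i j k : ι)
    (I1 I2 : Finset ι)
    (hfull : (N (f i) ∩ S).card = (Finset.univ.filter fun j => T i j = true).card)
    (h : i ∉ I ∧ j ≠ k ∧ (Finset.univ.filter (fun j => T i j = true ∧ j ∉ I)) = {j, k} ∧
      insert i (insert j I) = I1 ∧ insert i (insert k I) = I2) :
    pq N S f I = pq N S f I1 + pq N S f I2 := by
  obtain ⟨hi, hjk, h1, h2, h3⟩ := h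
  rw [hC.expand hG I i hi hfull, h1, Finset.sum_pair hjk, h2, h3]

theorem Conf.ex3 (hG : BGraph N col) (hC : Conf N S T f) (I : Finset ι) (i j k l : ι)
    (I1 I2 I3 : Finset ι)
    (hfull : (N (f i) ∩ S).card = (Finset.univ.filter fun j => T i j = true).card)
    (h : i ∉ I ∧ (j ≠ k ∧ j ≠ l ∧ k ≠ l) ∧
      (Finset.univ.filter (fun j => T i j = true ∧ j ∉ I)) = {j, k, l} ∧
      insert i (insert j I) = I1 ∧ insert i (insert k I) = I2 ∧ insert i (insert l I) = I3) :
    pq N S f I = pq N S f I1 + pq N S f I2 + pq N S f I3 := by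
  obtain ⟨hi, ⟨hjk, hjl, hkl⟩, h1, h2, h3, h4⟩ := h
  rw [hC.expand hG I i hi hfull, h1, Finset.sum_insert (by simp [hjk, hjl]), Finset.sum_pair hkl,
    h2, h3, h4, add_assoc]

end Steps

theorem inj1 (a : V) : Function.Injective ![a] := by
  intro i j _; exact Subsingleton.elim _ _

theorem inj2 {a b : V} (h : a ≠ b) : Function.Injective ![a, b] := by
  intro i j hij
  fin_cases i <;> fin_cases j <;> simp_all

theorem inj3 {a b c : V} (h1 : a ≠ b) (h2 : a ≠ c) (h3 : b ≠ c) :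
    Function.Injective ![a, b, c] := by
  intro i j hij
  fin_cases i <;> fin_cases j <;> simp_all

theorem inj4 {a b c d : V} (h1 : a ≠ b) (h2 : a ≠ c) (h3 : a ≠ d) (h4 : b ≠ c) (h5 : b ≠ d)
    (h6 : c ≠ d) : Function.Injective ![a, b, c, d] := by
  intro i j hij
  fin_cases i <;> fin_cases j <;> simp_all

section Low

variable {N : V → Finset V} {col : V → Bool} {S : Finset V}

theorem nbS {v u : V} {A : Finset V} (h : N v ∩ S = A) (hu : u ∈ A) : u ∈ N v ∧ u ∈ S := by
  rw [← h] at hu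
  exact Finset.mem_inter.1 hu

/-- A vertex of degree one. -/
theorem low1 (hG : BGraph N col) (hd : ∀ v ∈ S, (N v ∩ S).card ≤ 3)
    (ih : ∀ S' ⊂ S, (pmc N S') ^ 4 ≤ dprod N S') {b : ℝ} (hb : (dprod N S : ℝ) = b ^ 4)
    (hb0 : 0 ≤ b) {v u : V} (hv : v ∈ S) (h : N v ∩ S = {u}) (c : ℝ) (hc0 : 0 ≤ c)
    (hc : (2 / 3 : ℝ) ^ ((N u ∩ S).card - 1) ≤ c ^ 4 * (N u ∩ S).card) :
    (pmc N S : ℝ) ≤ c * b := by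
  have hu := nbS h (Finset.mem_singleton_self u)
  have hC : Conf N S (tb (fun _ _ => true)) (Sum.elim ![v] ![u]) :=
    Conf.mk' hG (col v) (by simp) (by intro j; fin_cases j; exact hG.bip _ _ hu.1)
      (inj1 v) (inj1 u) (by simp [hv]) (by simp [hu.2]) (by simp [hu.1])
  have hupos : 1 ≤ (N u ∩ S).card :=
    Finset.card_pos.2 ⟨v, Finset.mem_inter.2 ⟨hG.symm _ _ hu.1, hv⟩⟩
  have hdg : ∀ i, (N (Sum.elim ![v] ![u] i) ∩ S).card =
      (Sum.elim ![1] ![(N u ∩ S).card] : Fin 1 ⊕ Fin 1 → ℕ) i := by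
    rintro (i | i) <;> fin_cases i <;> simp [h]
  have e1 := hC.ex1 hG ∅ (Sum.inl 0) (Sum.inr 0) Finset.univ
    (by rw [hdg]; simp; decide) (by decide)
  rw [← pq_empty (f := (Sum.elim ![v] ![u] : Fin 1 ⊕ Fin 1 → V)), e1]
  refine hC.pbound hG hd ih _ hdg ?_ Finset.univ Finset.univ_nonempty ((N u ∩ S).card - 1) ?_
    (N u ∩ S).card (by simp) c b hb hb0 hc0 ?_
  · rintro (i | i) <;> fin_cases i <;> simp
    exact ⟨v, Finset.mem_inter.2 ⟨hG.symm _ _ hu.1, hv⟩⟩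
  · have := hd u hu.2
    generalize (N u ∩ S).card = d at *
    interval_cases d <;> decide
  · exact hc

/-- A vertex of degree one whose neighbour has larger degree. -/
theorem low1' (hG : BGraph N col) (hd : ∀ v ∈ S, (N v ∩ S).card ≤ 3)
    (ih : ∀ S' ⊂ S, (pmc N S') ^ 4 ≤ dprod N S') {b : ℝ} (hb : (dprod N S : ℝ) = b ^ 4)
    (hb0 : 0 ≤ b) {v u : V} (hv : v ∈ S) (h : N v ∩ S = {u}) (hu2 : 2 ≤ (N u ∩ S).card) :
    (pmc N S : ℝ) ≤ (943 / 1000) * b := by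
  apply low1 hG hd ih hb hb0 hv h _ (by norm_num)
  have := hd u (nbS h (Finset.mem_singleton_self u)).2
  generalize (N u ∩ S).card = d at *
  interval_cases d <;> norm_num

/-- A vertex of degree two with two neighbours of degree three. -/
theorem low33 (hG : BGraph N col) (hd : ∀ v ∈ S, (N v ∩ S).card ≤ 3)
    (ih : ∀ S' ⊂ S, (pmc N S') ^ 4 ≤ dprod N S') {b : ℝ} (hb : (dprod N S : ℝ) = b ^ 4)
    (hb0 : 0 ≤ b) {v u w : V} (hv : v ∈ S) (h : N v ∩ S = {u, w}) (huw : u ≠ w)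
    (hu3 : (N u ∩ S).card = 3) (hw3 : (N w ∩ S).card = 3) :
    (pmc N S : ℝ) ≤ (943 / 1000) * b := by
  have hu := nbS h (u := u) (by simp)
  have hw := nbS h (u := w) (by simp)
  have hC : Conf N S (tb (fun _ _ => true)) (Sum.elim ![v] ![u, w]) :=
    Conf.mk' hG (col v) (by simp)
      (by intro j; fin_cases j; exacts [hG.bip _ _ hu.1, hG.bip _ _ hw.1])
      (inj1 v) (inj2 huw) (by simp [hv])
      (by intro j; fin_cases j; exacts [hu.2, hw.2])
      (by intro i j; fin_cases i; fin_cases j <;> simp [hu.1, hw.1])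
  have hdg : ∀ i, (N (Sum.elim ![v] ![u, w] i) ∩ S).card =
      (Sum.elim ![2] ![3, 3] : Fin 1 ⊕ Fin 2 → ℕ) i := by
    rintro (i | i) <;> fin_cases i <;> simp [h, Finset.card_pair huw, hu3, hw3]
  have e1 := hC.ex2 hG ∅ (Sum.inl 0) (Sum.inr 0) (Sum.inr 1) {Sum.inl 0, Sum.inr 0}
    {Sum.inl 0, Sum.inr 1} (by rw [hdg]; decide) (by decide)
  have b1 := hC.pbound hG hd ih _ hdg (by decide) {Sum.inl 0, Sum.inr 0} (by simp) 3 (by decide) 6 (by decide)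
    (4715 / 10000) b hb hb0 (by norm_num) (by norm_num)
  have b2 := hC.pbound hG hd ih _ hdg (by decide) {Sum.inl 0, Sum.inr 1} (by simp) 3 (by decide) 6 (by decide)
    (4715 / 10000) b hb hb0 (by norm_num) (by norm_num)
  rw [← pq_empty (f := (Sum.elim ![v] ![u, w] : Fin 1 ⊕ Fin 2 → V)), e1]
  push_cast
  linarith

/-- Two adjacent vertices of degree two: configuration. -/
theorem conf22 (hG : BGraph N col) {v u w x : V}
    (hv : v ∈ S) (hu : u ∈ S) (h : N v ∩ S = {u, w}) (huw : u ≠ w)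
    (h' : N u ∩ S = {v, x}) (hvx : v ≠ x) (m : Bool) (hm : x ∈ N w ↔ m = true) :
    Conf N S (tb ![![true, true], ![true, m]]) (Sum.elim ![v, x] ![u, w]) := by
  have hu := nbS h (u := u) (by simp)
  have hw := nbS h (u := w) (by simp)
  have hx := nbS h' (u := x) (by simp)
  have c1 := hG.bip _ _ hu.1
  have c2 := hG.bip _ _ hx.1
  have hm' : w ∈ N x ↔ m = true := by
    rw [← hm]; exact ⟨fun h => hG.symm _ _ h, fun h => hG.symm _ _ h⟩
  exact Conf.mk' hG (col v)
      (by intro j; fin_cases j; exacts [rfl, by simp [c2, c1]])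
      (by intro j; fin_cases j; exacts [c1, hG.bip _ _ hw.1])
      (inj2 hvx) (inj2 huw)
      (by intro j; fin_cases j; exacts [hv, hx.2])
      (by intro j; fin_cases j; exacts [hu.2, hw.2])
      (by intro i j
          fin_cases i <;> fin_cases j <;> simp [hu.1, hw.1, hm', hG.symm _ _ hx.1])

/-- The generic estimate for two adjacent vertices of degree two. -/
theorem low22 (hG : BGraph N col) (hd : ∀ v ∈ S, (N v ∩ S).card ≤ 3)
    (ih : ∀ S' ⊂ S, (pmc N S') ^ 4 ≤ dprod N S') {b : ℝ} (hb : (dprod N S : ℝ) = b ^ 4)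
    (hb0 : 0 ≤ b) {v u w x : V}
    (hv : v ∈ S) (hu : u ∈ S) (h : N v ∩ S = {u, w}) (huw : u ≠ w)
    (h' : N u ∩ S = {v, x}) (hvx : v ≠ x) (m : Bool) (hm : x ∈ N w ↔ m = true)
    (dw dx : ℕ) (hdw : (N w ∩ S).card = dw) (hdx : (N x ∩ S).card = dx) (hdw0 : 0 < dw)
    (hdx0 : 0 < dx) (E : ℕ)
    (hE : E + 2 + (if m then 2 else 0) ≤ dw + dx) (c : ℝ) (hc0 : 0 ≤ c)
    (hc : (2 / 3 : ℝ) ^ E ≤ c ^ 4 * (4 * dw * dx)) :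
    (pmc N S : ℝ) ≤ (5774 / 10000 + c) * b := by
  have hC := conf22 hG hv hu h huw h' hvx m hm
  have hdg : ∀ i, (N (Sum.elim ![v, x] ![u, w] i) ∩ S).card =
      (Sum.elim ![2, dx] ![2, dw] : Fin 2 ⊕ Fin 2 → ℕ) i := by
    rintro (i | i) <;> fin_cases i <;>
      simp [h, h', Finset.card_pair huw, Finset.card_pair hvx, hdw, hdx]
  have hp : ∀ i, 0 < (Sum.elim ![2, dx] ![2, dw] : Fin 2 ⊕ Fin 2 → ℕ) i := by
    rintro (i | i) <;> fin_cases i <;> simp [hdw0, hdx0]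
  have e1 := hC.ex2 hG ∅ (Sum.inl 0) (Sum.inr 0) (Sum.inr 1) {Sum.inl 0, Sum.inr 0}
    {Sum.inl 0, Sum.inr 1} (by rw [hdg]; show 2 = _; cases m <;> decide) (by cases m <;> decide)
  have e2 := hC.ex1 hG {Sum.inl 0, Sum.inr 1} (Sum.inr 0) (Sum.inl 1) Finset.univ
    (by rw [hdg]; show 2 = _; cases m <;> decide) (by cases m <;> decide)
  have b1 := hC.pbound hG hd ih _ hdg hp {Sum.inl 0, Sum.inr 0} (by simp) 2
    (by rw [Finset.sum_pair (by decide)]; show 2 ≤ (2 - _) + (2 - _); cases m <;> decide)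
    4 (by rw [Finset.prod_pair (by decide)]; rfl)
    (5774 / 10000) b hb hb0 (by norm_num) (by norm_num)
  have b2 := hC.pbound hG hd ih _ hdg hp Finset.univ (by simp) E
    (by
      have e : ∀ i, (Finset.univ.filter fun j => tb ![![true, true], ![true, m]] i j = true).card
          = Sum.elim ![2, if m then 2 else 1] ![2, if m then 2 else 1] i := by
        clear * - m
        revert m; decide
      simp only [e]
      simp [Fin.sum_univ_two]
      cases m <;> simp at hE ⊢ <;> omega)
    (4 * dw * dx) (by simp [Fin.prod_univ_two]; ring)
    c b hb hb0 hc0 (by push_cast; linarith)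
  rw [← pq_empty (f := (Sum.elim ![v, x] ![u, w] : Fin 2 ⊕ Fin 2 → V)), e1, e2]
  push_cast
  linarith

theorem nb_one {v u : V} (h : (N v ∩ S).card = 1) (hu : u ∈ N v) (hu' : u ∈ S) :
    N v ∩ S = {u} := by
  obtain ⟨z, hz⟩ := Finset.card_eq_one.1 h
  have := Finset.mem_inter.2 ⟨hu, hu'⟩
  rw [hz, Finset.mem_singleton] at this
  rw [hz, this]

theorem nb_two {v u : V} (h : (N v ∩ S).card = 2) (hu : u ∈ N v) (hu' : u ∈ S) :
    ∃ w, u ≠ w ∧ N v ∩ S = {u, w} := by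
  obtain ⟨y, z, hyz, e⟩ := Finset.card_eq_two.1 h
  have := Finset.mem_inter.2 ⟨hu, hu'⟩
  rw [e, Finset.mem_insert, Finset.mem_singleton] at this
  rcases this with rfl | rfl
  · exact ⟨z, hyz, e⟩
  · exact ⟨y, hyz.symm, by rw [e, Finset.pair_comm]⟩

theorem low22na (hG : BGraph N col) (hd : ∀ v ∈ S, (N v ∩ S).card ≤ 3)
    (ih : ∀ S' ⊂ S, (pmc N S') ^ 4 ≤ dprod N S') {b : ℝ} (hb : (dprod N S : ℝ) = b ^ 4)
    (hb0 : 0 ≤ b) {v u w x : V}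
    (hv : v ∈ S) (hu : u ∈ S) (h : N v ∩ S = {u, w}) (huw : u ≠ w)
    (h' : N u ∩ S = {v, x}) (hvx : v ≠ x) (hm : x ∉ N w) :
    (pmc N S : ℝ) ≤ (943 / 1000) * b := by
  have hw := nbS h (u := w) (by simp)
  have hx := nbS h' (u := x) (by simp)
  have hvw := hG.symm _ _ hw.1
  have hux := hG.symm _ _ hx.1
  have dv : (N v ∩ S).card = 2 := by rw [h, Finset.card_pair huw]
  have du : (N u ∩ S).card = 2 := by rw [h', Finset.card_pair hvx]
  have hw1 : 0 < (N w ∩ S).card := Finset.card_pos.2 ⟨v, Finset.mem_inter.2 ⟨hvw, hv⟩⟩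
  have hx1 : 0 < (N x ∩ S).card := Finset.card_pos.2 ⟨u, Finset.mem_inter.2 ⟨hux, hu⟩⟩
  have hw3 := hd w hw.2
  have hx3 := hd x hx.2
  by_cases hw0 : (N w ∩ S).card = 1
  · exact low1' hG hd ih hb hb0 hw.2 (nb_one hw0 hvw hv) (by omega)
  by_cases hx0 : (N x ∩ S).card = 1
  · exact low1' hG hd ih hb hb0 hx.2 (nb_one hx0 hux hu) (by omega)
  by_cases hwx : (N w ∩ S).card = 2 ∧ (N x ∩ S).card = 2
  · obtain ⟨y, hvy, hy⟩ := nb_two hwx.1 hvw hv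
    have hy' := nbS hy (u := y) (by simp)
    have hyw := hG.symm _ _ hy'.1
    have hy1 : 0 < (N y ∩ S).card := Finset.card_pos.2 ⟨w, Finset.mem_inter.2 ⟨hyw, hw.2⟩⟩
    have hy3 := hd y hy'.2
    by_cases hy0 : (N y ∩ S).card = 1
    · exact low1' hG hd ih hb hb0 hy'.2 (nb_one hy0 hyw hw.2) (by omega)
    have hxy : x ≠ y := by rintro rfl; exact hm hy'.1
    have hu1 := nbS h (u := u) (by simp)
    have c1 := hG.bip _ _ hu1.1
    have c2 := hG.bip _ _ hw.1
    have c3 := hG.bip _ _ hx.1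
    have c4 := hG.bip _ _ hy'.1
    have huy : u ∉ N y := by
      intro hh
      have : y ∈ N u ∩ S := Finset.mem_inter.2 ⟨hG.symm _ _ hh, hy'.2⟩
      rw [h'] at this
      simp [hvy.symm, hxy.symm] at this
    have hwx' : w ∉ N x := fun hh => hm (hG.symm _ _ hh)
    have hC : Conf N S (tb ![![true, true], ![true, false], ![false, true]])
        (Sum.elim ![v, x, y] ![u, w]) :=
      Conf.mk' hG (col v)
        (by intro j; fin_cases j; exacts [rfl, by simp [c3, c1], by simp [c4, c2]])
        (by intro j; fin_cases j; exacts [c1, c2])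
        (inj3 hvx hvy hxy) (inj2 huw)
        (by intro j; fin_cases j; exacts [hv, hx.2, hy'.2])
        (by intro j; fin_cases j; exacts [hu, hw.2])
        (by intro i j
            fin_cases i <;> fin_cases j <;> simp [hu1.1, hw.1, hux, hyw, huy, hwx'])
    obtain ⟨dy, hdy⟩ : ∃ dy, (N y ∩ S).card = dy := ⟨_, rfl⟩
    have hdg : ∀ i, (N (Sum.elim ![v, x, y] ![u, w] i) ∩ S).card =
        (Sum.elim ![2, 2, dy] ![2, 2] : Fin 3 ⊕ Fin 2 → ℕ) i := by
      rintro (i | i) <;> fin_cases i <;> simp [dv, du, hwx.1, hwx.2, hdy]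
    have e1 := hC.ex2 hG ∅ (Sum.inl 0) (Sum.inr 0) (Sum.inr 1) {Sum.inl 0, Sum.inr 0}
      {Sum.inl 0, Sum.inr 1} (by rw [hdg]; show 2 = _; decide) (by decide)
    have e2 := hC.ex1 hG {Sum.inl 0, Sum.inr 0} (Sum.inr 1) (Sum.inl 2)
      {Sum.inl 0, Sum.inr 0, Sum.inr 1, Sum.inl 2} (by rw [hdg]; show 2 = _; decide) (by decide)
    have e3 := hC.ex1 hG {Sum.inl 0, Sum.inr 1} (Sum.inr 0) (Sum.inl 1)
      {Sum.inl 0, Sum.inr 0, Sum.inr 1, Sum.inl 1} (by rw [hdg]; show 2 = _; decide) (by decide)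
    have b1 : (pq N S (Sum.elim ![v, x, y] ![u, w])
        {Sum.inl 0, Sum.inr 0, Sum.inr 1, Sum.inl 2} : ℝ) ≤ (409 / 1000) * b := by
      have : dy = 2 ∨ dy = 3 := by omega
      rcases this with rfl | rfl
      · exact hC.pbound hG hd ih _ hdg (by decide) _ (by simp) 2 (by decide) 16 (by decide) (409 / 1000) b hb hb0
          (by norm_num) (by norm_num)
      · exact hC.pbound hG hd ih _ hdg (by decide) _ (by simp) 3 (by decide) 24 (by decide) (409 / 1000) b hb hb0
          (by norm_num) (by norm_num)
    have b2 : (pq N S (Sum.elim ![v, x, y] ![u, w])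
        {Sum.inl 0, Sum.inr 0, Sum.inr 1, Sum.inl 1} : ℝ) ≤ (409 / 1000) * b := by
      have : dy = 2 ∨ dy = 3 := by omega
      rcases this with rfl | rfl <;>
      exact hC.pbound hG hd ih _ hdg (by decide) _ (by simp) 2 (by decide) 16 (by decide) (409 / 1000) b hb hb0
          (by norm_num) (by norm_num)
    rw [← pq_empty (f := (Sum.elim ![v, x, y] ![u, w] : Fin 3 ⊕ Fin 2 → V)), e1, e2, e3]
    push_cast
    linarith
  · obtain ⟨dw, hdw⟩ : ∃ d, (N w ∩ S).card = d := ⟨_, rfl⟩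
    obtain ⟨dx, hdx⟩ : ∃ d, (N x ∩ S).card = d := ⟨_, rfl⟩
    rw [hdw] at hw1 hw3 hw0 hwx
    rw [hdx] at hx1 hx3 hx0 hwx
    refine (low22 hG hd ih hb hb0 hv hu h huw h' hvx false (by simpa using hm) dw dx hdw hdx hw1 hx1
      3 (by simp; omega) (334 / 1000) (by norm_num) ?_).trans ?_
    · interval_cases dw <;> interval_cases dx <;> first | omega | norm_num
    · nlinarith

theorem low22a (hG : BGraph N col) (hd : ∀ v ∈ S, (N v ∩ S).card ≤ 3)
    (ih : ∀ S' ⊂ S, (pmc N S') ^ 4 ≤ dprod N S') {b : ℝ} (hb : (dprod N S : ℝ) = b ^ 4)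
    (hb0 : 0 ≤ b) {v u w x : V}
    (hv : v ∈ S) (hu : u ∈ S) (h : N v ∩ S = {u, w}) (huw : u ≠ w)
    (h' : N u ∩ S = {v, x}) (hvx : v ≠ x) (hm : x ∈ N w) :
    (pmc N S : ℝ) ≤ b := by
  have hw := nbS h (u := w) (by simp)
  have hx := nbS h' (u := x) (by simp)
  have hvw := hG.symm _ _ hw.1
  have hux := hG.symm _ _ hx.1
  have hwx' := hG.symm _ _ hm
  have hw2 : 1 < (N w ∩ S).card := Finset.one_lt_card.2
    ⟨v, Finset.mem_inter.2 ⟨hvw, hv⟩, x, Finset.mem_inter.2 ⟨hm, hx.2⟩, hvx⟩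
  have hx2 : 1 < (N x ∩ S).card := Finset.one_lt_card.2
    ⟨u, Finset.mem_inter.2 ⟨hux, hu⟩, w, Finset.mem_inter.2 ⟨hwx', hw.2⟩, huw⟩
  have hw3 := hd w hw.2
  have hx3 := hd x hx.2
  by_cases hwx : (N w ∩ S).card = 2 ∧ (N x ∩ S).card = 2
  · have hC := conf22 hG hv hu h huw h' hvx true (by simp [hm])
    have hdg : ∀ i, (N (Sum.elim ![v, x] ![u, w] i) ∩ S).card =
        (fun _ => 2 : Fin 2 ⊕ Fin 2 → ℕ) i := by
      rintro (i | i) <;> fin_cases i <;>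
        simp [h, h', Finset.card_pair huw, Finset.card_pair hvx, hwx.1, hwx.2]
    have e1 := hC.ex2 hG ∅ (Sum.inl 0) (Sum.inr 0) (Sum.inr 1) {Sum.inl 0, Sum.inr 0}
      {Sum.inl 0, Sum.inr 1} (by rw [hdg]; decide) (by decide)
    have e2 := hC.ex1 hG {Sum.inl 0, Sum.inr 1} (Sum.inr 0) (Sum.inl 1) Finset.univ
      (by rw [hdg]; decide) (by decide)
    have e3 := hC.ex1 hG {Sum.inl 0, Sum.inr 0} (Sum.inr 1) (Sum.inl 1) Finset.univ
      (by rw [hdg]; decide) (by decide)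
    have b1 := hC.pbound hG hd ih _ hdg (by decide) Finset.univ (by simp) 0 (by decide) 16 (by decide)
      (1 / 2) b hb hb0 (by norm_num) (by norm_num)
    rw [← pq_empty (f := (Sum.elim ![v, x] ![u, w] : Fin 2 ⊕ Fin 2 → V)), e1, e2, e3]
    push_cast
    linarith
  · obtain ⟨dw, hdw⟩ : ∃ d, (N w ∩ S).card = d := ⟨_, rfl⟩
    obtain ⟨dx, hdx⟩ : ∃ d, (N x ∩ S).card = d := ⟨_, rfl⟩
    rw [hdw] at hw2 hw3 hwx
    rw [hdx] at hx2 hx3 hwx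
    refine (low22 hG hd ih hb hb0 hv hu h huw h' hvx true (by simpa using hm) dw dx hdw hdx
      (by omega) (by omega)
      1 (by simp; omega) (4083 / 10000) (by norm_num) ?_).trans ?_
    · interval_cases dw <;> interval_cases dx <;> first | omega | norm_num
    · nlinarith

/-- A vertex of degree two. -/
theorem low2 (hG : BGraph N col) (hd : ∀ v ∈ S, (N v ∩ S).card ≤ 3)
    (ih : ∀ S' ⊂ S, (pmc N S') ^ 4 ≤ dprod N S') {b : ℝ} (hb : (dprod N S : ℝ) = b ^ 4)
    (hb0 : 0 ≤ b) {v : V} (hv : v ∈ S) (h : (N v ∩ S).card = 2) :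
    (pmc N S : ℝ) ≤ (943 / 1000) * b ∨ ((pmc N S : ℝ) ≤ b ∧
      ∃ u ∈ N v ∩ S, ∃ w ∈ N v ∩ S, u ≠ w ∧ ∃ x ∈ N u ∩ S, x ∈ N w ∧ x ≠ v) := by
  have main : ∀ u w, N v ∩ S = {u, w} → u ≠ w → (N u ∩ S).card = 2 →
      (pmc N S : ℝ) ≤ (943 / 1000) * b ∨ ((pmc N S : ℝ) ≤ b ∧
      ∃ u ∈ N v ∩ S, ∃ w ∈ N v ∩ S, u ≠ w ∧ ∃ x ∈ N u ∩ S, x ∈ N w ∧ x ≠ v) := by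
    intro u w e huw h2
    have hu := nbS e (u := u) (by simp)
    have hw := nbS e (u := w) (by simp)
    obtain ⟨x, hvx, ex⟩ := nb_two h2 (hG.symm _ _ hu.1) hv
    by_cases hx : x ∈ N w
    · exact Or.inr ⟨low22a hG hd ih hb hb0 hv hu.2 e huw ex hvx hx,
        u, Finset.mem_inter.2 hu, w, Finset.mem_inter.2 hw, huw, x,
        Finset.mem_inter.2 (nbS ex (by simp)), hx, hvx.symm⟩
    · exact Or.inl (low22na hG hd ih hb hb0 hv hu.2 e huw ex hvx hx)
  obtain ⟨u, w, huw, e⟩ := Finset.card_eq_two.1 h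
  have hu := nbS e (u := u) (by simp)
  have hw := nbS e (u := w) (by simp)
  have hu1 : 0 < (N u ∩ S).card :=
    Finset.card_pos.2 ⟨v, Finset.mem_inter.2 ⟨hG.symm _ _ hu.1, hv⟩⟩
  have hw1 : 0 < (N w ∩ S).card :=
    Finset.card_pos.2 ⟨v, Finset.mem_inter.2 ⟨hG.symm _ _ hw.1, hv⟩⟩
  have hu3 := hd u hu.2
  have hw3 := hd w hw.2
  by_cases a1 : (N u ∩ S).card = 1
  · exact Or.inl (low1' hG hd ih hb hb0 hu.2 (nb_one a1 (hG.symm _ _ hu.1) hv) (by omega))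
  by_cases a2 : (N w ∩ S).card = 1
  · exact Or.inl (low1' hG hd ih hb hb0 hw.2 (nb_one a2 (hG.symm _ _ hw.1) hv) (by omega))
  by_cases a3 : (N u ∩ S).card = 2
  · exact main u w e huw a3
  by_cases a4 : (N w ∩ S).card = 2
  · exact main w u (by rw [e, Finset.pair_comm]) huw.symm a4
  exact Or.inl (low33 hG hd ih hb hb0 hv e huw (by omega) (by omega))

end Low

section Cubic

variable {N : V → Finset V} {col : V → Bool} {S : Finset V}

theorem root4 (x : ℕ) : ∃ b : ℝ, 0 ≤ b ∧ (x : ℝ) = b ^ 4 := by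
  refine ⟨Real.sqrt (Real.sqrt x), Real.sqrt_nonneg _, ?_⟩
  have h1 : Real.sqrt (Real.sqrt x) ^ 2 = Real.sqrt x := Real.sq_sqrt (Real.sqrt_nonneg _)
  have h2 : Real.sqrt (x : ℝ) ^ 2 = x := Real.sq_sqrt (Nat.cast_nonneg _)
  calc (x : ℝ) = Real.sqrt (x : ℝ) ^ 2 := h2.symm
    _ = (Real.sqrt (Real.sqrt x) ^ 2) ^ 2 := by rw [h1]
    _ = _ := by ring

theorem nb_three {v a b : V} (h : (N v ∩ S).card = 3) (ha : a ∈ N v) (ha' : a ∈ S)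
    (hb : b ∈ N v) (hb' : b ∈ S) (hab : a ≠ b) :
    ∃ c, c ≠ a ∧ c ≠ b ∧ N v ∩ S = {a, b, c} := by
  have hs : ({a, b} : Finset V) ⊆ N v ∩ S := by
    intro y hy
    simp only [Finset.mem_insert, Finset.mem_singleton] at hy
    rcases hy with rfl | rfl <;> simp [*]
  have h1 : ((N v ∩ S) \ {a, b}).card = 1 := by
    rw [Finset.card_sdiff_of_subset hs, h, Finset.card_pair hab]
  obtain ⟨c, hc⟩ := Finset.card_eq_one.1 h1
  have hc' : c ∈ (N v ∩ S) \ {a, b} := by rw [hc]; simp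
  simp only [Finset.mem_sdiff, Finset.mem_insert, Finset.mem_singleton, not_or] at hc'
  refine ⟨c, hc'.2.1, hc'.2.2, ?_⟩
  have := Finset.sdiff_union_of_subset hs
  rw [hc] at this
  rw [← this]
  ext y; simp; tauto

theorem nb_eq3 {v a b c : V} (h : (N v ∩ S).card = 3) (ha : a ∈ N v) (ha' : a ∈ S)
    (hb : b ∈ N v) (hb' : b ∈ S) (hc : c ∈ N v) (hc' : c ∈ S) (hab : a ≠ b) (hac : a ≠ c)
    (hbc : b ≠ c) : N v ∩ S = {a, b, c} := by
  symm
  apply Finset.eq_of_subset_of_card_le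
  · intro y hy
    simp only [Finset.mem_insert, Finset.mem_singleton] at hy
    rcases hy with rfl | rfl | rfl <;> simp [*]
  · rw [h, Finset.card_eq_three.2 ⟨a, b, c, hab, hac, hbc, rfl⟩]

theorem bex (p : Prop) : ∃ m : Bool, p ↔ m = true := by
  by_cases h : p
  · exact ⟨true, by simp [h]⟩
  · exact ⟨false, by simp [h]⟩

theorem same_term (hG : BGraph N col) (h3 : ∀ v ∈ S, (N v ∩ S).card = 3)
    (ih : ∀ S' ⊂ S, (pmc N S') ^ 4 ≤ dprod N S') {b : ℝ} (hb : (dprod N S : ℝ) = b ^ 4)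
    (hb0 : 0 ≤ b) {v v' x u1 u2 u3 : V} (mv : v ∈ S) (mv' : v' ∈ S) (mx : x ∈ S)
    (m1 : u1 ∈ S) (m2 : u2 ∈ S) (m3 : u3 ∈ S)
    (a1 : u1 ∈ N v) (a2 : u2 ∈ N v) (a3 : u3 ∈ N v)
    (b1 : u1 ∈ N v') (b2 : u2 ∈ N v') (b3 : u3 ∈ N v') (hx : u1 ∈ N x)
    (d1 : v ≠ v') (d2 : v ≠ x) (d3 : v' ≠ x) (d4 : u1 ≠ u2) (d5 : u1 ≠ u3) (d6 : u2 ≠ u3)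
    (hn : ¬ (u2 ∈ N x ∧ u3 ∈ N x)) :
    (pmc N (S \ {v, v', u2, u3}) : ℝ) ≤ 1572 / 10000 * b := by
  obtain ⟨p, hp⟩ := bex (u2 ∈ N x)
  obtain ⟨q, hq⟩ := bex (u3 ∈ N x)
  have hpq : (p && q) = false := by
    rw [hp, hq] at hn
    cases p <;> cases q <;> simp_all
  have c1 := hG.bip _ _ a1
  have c2 := hG.bip _ _ a2
  have c3 := hG.bip _ _ a3
  have c4 : col v' = col v := by
    have := hG.bip _ _ b1
    rw [c1] at this
    simpa using this.symm
  have c5 : col x = col v := by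
    have := hG.bip _ _ hx
    rw [c1] at this
    simpa using this.symm
  have hC : Conf N S (tb ![![true, true, true], ![true, true, true], ![true, p, q]])
      (Sum.elim ![v, v', x] ![u1, u2, u3]) :=
    Conf.mk' hG (col v)
      (by intro j; fin_cases j; exacts [rfl, c4, c5])
      (by intro j; fin_cases j; exacts [c1, c2, c3])
      (inj3 d1 d2 d3) (inj3 d4 d5 d6)
      (by intro j; fin_cases j; exacts [mv, mv', mx])
      (by intro j; fin_cases j; exacts [m1, m2, m3])
      (by intro i j
          fin_cases i <;> fin_cases j <;> simp [a1, a2, a3, b1, b2, b3, hx, hp, hq])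
  have hdg : ∀ i, (N (Sum.elim ![v, v', x] ![u1, u2, u3] i) ∩ S).card =
      (fun _ => 3 : Fin 3 ⊕ Fin 3 → ℕ) i := fun i => h3 _ (hC.mem i)
  have e1 := hC.ex1 hG {Sum.inl 0, Sum.inl 1, Sum.inr 1, Sum.inr 2} (Sum.inr 0) (Sum.inl 2)
    Finset.univ (by rw [hdg]; cases p <;> cases q <;> decide) (by cases p <;> cases q <;> decide)
  have b1 := hC.pbound hG (fun v hv => (h3 v hv).le) ih _ hdg (by decide) Finset.univ (by simp) 2
    (by clear * - hpq; revert p q; decide) 729 (by decide)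
    (1572 / 10000) b hb hb0 (by norm_num) (by norm_num)
  rw [← e1] at b1
  simpa [pq] using b1

/-- Two vertices with the same three neighbours. -/
theorem same_support (hG : BGraph N col) (h3 : ∀ v ∈ S, (N v ∩ S).card = 3)
    (ih : ∀ S' ⊂ S, (pmc N S') ^ 4 ≤ dprod N S') {b : ℝ} (hb : (dprod N S : ℝ) = b ^ 4)
    (hb0 : 0 ≤ b)
    (hJ : ∀ a b : Fin 3 → V, Function.Injective a → Function.Injective b → (∀ i, a i ∈ S) →
      (∀ i, b i ∈ S) → ¬ ∀ i j, b j ∈ N (a i))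
    {v v' u1 u2 u3 : V} (mv : v ∈ S) (mv' : v' ∈ S)
    (m1 : u1 ∈ S) (m2 : u2 ∈ S) (m3 : u3 ∈ S)
    (a1 : u1 ∈ N v) (a2 : u2 ∈ N v) (a3 : u3 ∈ N v)
    (b1 : u1 ∈ N v') (b2 : u2 ∈ N v') (b3 : u3 ∈ N v')
    (d1 : v ≠ v') (d4 : u1 ≠ u2) (d5 : u1 ≠ u3) (d6 : u2 ≠ u3) :
    (pmc N S : ℝ) ≤ b := by
  have key : ∀ u1 u2 u3 : V, u1 ∈ S → u2 ∈ S → u3 ∈ S → u1 ∈ N v → u2 ∈ N v → u3 ∈ N v →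
      u1 ∈ N v' → u2 ∈ N v' → u3 ∈ N v' → u1 ≠ u2 → u1 ≠ u3 → u2 ≠ u3 →
      (pmc N (S \ {v, v', u2, u3}) : ℝ) ≤ 1572 / 10000 * b := by
    intro u1 u2 u3 m1 m2 m3 a1 a2 a3 b1 b2 b3 d4 d5 d6
    obtain ⟨x, hxv, hxv', e⟩ := nb_three (h3 u1 m1) (hG.symm _ _ a1) mv (hG.symm _ _ b1) mv' d1
    have hx := nbS e (u := x) (by simp)
    have hx' := hG.symm _ _ hx.1
    refine same_term hG h3 ih hb hb0 mv mv' hx.2 m1 m2 m3 a1 a2 a3 b1 b2 b3 hx' d1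
      hxv.symm hxv'.symm d4 d5 d6 ?_
    rintro ⟨h2, h3⟩
    refine hJ ![v, v', x] ![u1, u2, u3] (inj3 d1 hxv.symm hxv'.symm) (inj3 d4 d5 d6) ?_ ?_ ?_
    · intro j; fin_cases j; exacts [mv, mv', hx.2]
    · intro j; fin_cases j; exacts [m1, m2, m3]
    · intro i j
      fin_cases i <;> fin_cases j <;> simp [*]
  have k1 := key u1 u2 u3 m1 m2 m3 a1 a2 a3 b1 b2 b3 d4 d5 d6
  have k2 := key u2 u1 u3 m2 m1 m3 a2 a1 a3 b2 b1 b3 d4.symm d6 d5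
  have k3 := key u3 u1 u2 m3 m1 m2 a3 a1 a2 b3 b1 b2 d5.symm d6.symm d4
  have c1 := hG.bip _ _ a1
  have c4 : col v' = col v := by
    have := hG.bip _ _ b1
    rw [c1] at this
    simpa using this.symm
  have hC : Conf N S (tb ![![true, true, true], ![true, true, true]])
      (Sum.elim ![v, v'] ![u1, u2, u3]) :=
    Conf.mk' hG (col v)
      (by intro j; fin_cases j; exacts [rfl, c4])
      (by intro j; fin_cases j; exacts [c1, hG.bip _ _ a2, hG.bip _ _ a3])
      (inj2 d1) (inj3 d4 d5 d6)
      (by intro j; fin_cases j; exacts [mv, mv'])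
      (by intro j; fin_cases j; exacts [m1, m2, m3])
      (by intro i j
          fin_cases i <;> fin_cases j <;> simp [a1, a2, a3, b1, b2, b3])
  have hdg : ∀ i, (N (Sum.elim ![v, v'] ![u1, u2, u3] i) ∩ S).card =
      (fun _ => 3 : Fin 2 ⊕ Fin 3 → ℕ) i := fun i => h3 _ (hC.mem i)
  have e1 := hC.ex3 hG ∅ (Sum.inl 0) (Sum.inr 0) (Sum.inr 1) (Sum.inr 2) {Sum.inl 0, Sum.inr 0}
    {Sum.inl 0, Sum.inr 1} {Sum.inl 0, Sum.inr 2} (by rw [hdg]; decide) (by decide)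
  have e2 := hC.ex2 hG {Sum.inl 0, Sum.inr 0} (Sum.inl 1) (Sum.inr 1) (Sum.inr 2)
    {Sum.inl 0, Sum.inl 1, Sum.inr 0, Sum.inr 1} {Sum.inl 0, Sum.inl 1, Sum.inr 0, Sum.inr 2}
    (by rw [hdg]; decide) (by decide)
  have e3 := hC.ex2 hG {Sum.inl 0, Sum.inr 1} (Sum.inl 1) (Sum.inr 0) (Sum.inr 2)
    {Sum.inl 0, Sum.inl 1, Sum.inr 0, Sum.inr 1} {Sum.inl 0, Sum.inl 1, Sum.inr 1, Sum.inr 2}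
    (by rw [hdg]; decide) (by decide)
  have e4 := hC.ex2 hG {Sum.inl 0, Sum.inr 2} (Sum.inl 1) (Sum.inr 0) (Sum.inr 1)
    {Sum.inl 0, Sum.inl 1, Sum.inr 0, Sum.inr 2} {Sum.inl 0, Sum.inl 1, Sum.inr 1, Sum.inr 2}
    (by rw [hdg]; decide) (by decide)
  have f1 : pq N S (Sum.elim ![v, v'] ![u1, u2, u3]) {Sum.inl 0, Sum.inl 1, Sum.inr 0, Sum.inr 1}
    = pmc N (S \ {v, v', u1, u2}) := by simp [pq]
  have f2 : pq N S (Sum.elim ![v, v'] ![u1, u2, u3]) {Sum.inl 0, Sum.inl 1, Sum.inr 0, Sum.inr 2}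
    = pmc N (S \ {v, v', u1, u3}) := by simp [pq]
  have f3 : pq N S (Sum.elim ![v, v'] ![u1, u2, u3]) {Sum.inl 0, Sum.inl 1, Sum.inr 1, Sum.inr 2}
    = pmc N (S \ {v, v', u2, u3}) := by simp [pq]
  rw [← pq_empty (f := (Sum.elim ![v, v'] ![u1, u2, u3] : Fin 2 ⊕ Fin 3 → V)), e1, e2, e3, e4,
    f1, f2, f3]
  push_cast
  linarith

end Cubic

section Cycle

variable {N : V → Finset V} {col : V → Bool} {S : Finset V}

/-- The generic 4-cycle configuration. -/
structure Cyc (N : V → Finset V) (S : Finset V) (v v' u u' t t' x x' : V) : Prop where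
  nv : N v ∩ S = {u, u', t}
  nv' : N v' ∩ S = {u, u', t'}
  nu : N u ∩ S = {v, v', x}
  nu' : N u' ∩ S = {v, v', x'}
  dv : v ≠ v'
  du : u ≠ u'
  dt : t ≠ t'
  dx : x ≠ x'
  tu : t ≠ u
  tu' : t ≠ u'
  tpu : t' ≠ u
  tpu' : t' ≠ u'
  xv : x ≠ v
  xv' : x ≠ v'
  xpv : x' ≠ v
  xpv' : x' ≠ v'

theorem Cyc.swapv {v v' u u' t t' x x' : V} (h : Cyc N S v v' u u' t t' x x') :
    Cyc N S v' v u u' t' t x x' where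
  nv := h.nv'
  nv' := h.nv
  nu := by rw [h.nu]; ext y; simp; tauto
  nu' := by rw [h.nu']; ext y; simp; tauto
  dv := h.dv.symm
  du := h.du
  dt := h.dt.symm
  dx := h.dx
  tu := h.tpu
  tu' := h.tpu'
  tpu := h.tu
  tpu' := h.tu'
  xv := h.xv'
  xv' := h.xv
  xpv := h.xpv'
  xpv' := h.xpv

theorem Cyc.swapu {v v' u u' t t' x x' : V} (h : Cyc N S v v' u u' t t' x x') :
    Cyc N S v v' u' u t t' x' x where
  nv := by rw [h.nv]; ext y; simp; tauto
  nv' := by rw [h.nv']; ext y; simp; tauto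
  nu := h.nu'
  nu' := h.nu
  dv := h.dv
  du := h.du.symm
  dt := h.dt
  dx := h.dx.symm
  tu := h.tu'
  tu' := h.tu
  tpu := h.tpu'
  tpu' := h.tpu
  xv := h.xpv
  xv' := h.xpv'
  xpv := h.xv
  xpv' := h.xv'

theorem Cyc.conf {v v' u u' t t' x x' : V} (h : Cyc N S v v' u u' t t' x x')
    (hG : BGraph N col) (m1 m2 m3 m4 : Bool)
    (h1 : t ∈ N x ↔ m1 = true) (h2 : t' ∈ N x ↔ m2 = true)
    (h3 : t ∈ N x' ↔ m3 = true) (h4 : t' ∈ N x' ↔ m4 = true) :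
    Conf N S (tb ![![true, true, true, false], ![true, true, false, true], ![true, false, m1, m2],
      ![false, true, m3, m4]]) (Sum.elim ![v, v', x, x'] ![u, u', t, t']) := by
  have a1 := nbS h.nv (u := u) (by simp)
  have a2 := nbS h.nv (u := u') (by simp)
  have a3 := nbS h.nv (u := t) (by simp)
  have b1 := nbS h.nv' (u := u) (by simp)
  have b2 := nbS h.nv' (u := u') (by simp)
  have b3 := nbS h.nv' (u := t') (by simp)
  have e1 := nbS h.nu (u := v) (by simp)
  have e2 := nbS h.nu (u := v') (by simp)
  have e3 := nbS h.nu (u := x) (by simp)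
  have f3 := nbS h.nu' (u := x') (by simp)
  have e3' := hG.symm _ _ e3.1
  have f3' := hG.symm _ _ f3.1
  have n1 : t' ∉ N v := by
    intro hh
    have : t' ∈ N v ∩ S := Finset.mem_inter.2 ⟨hh, b3.2⟩
    rw [h.nv] at this
    simp [h.tpu, h.tpu', h.dt.symm] at this
  have n2 : t ∉ N v' := by
    intro hh
    have : t ∈ N v' ∩ S := Finset.mem_inter.2 ⟨hh, a3.2⟩
    rw [h.nv'] at this
    simp [h.tu, h.tu', h.dt] at this
  have n3 : u' ∉ N x := by
    intro hh
    have : x ∈ N u' ∩ S := Finset.mem_inter.2 ⟨hG.symm _ _ hh, e3.2⟩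
    rw [h.nu'] at this
    simp [h.xv, h.xv', h.dx] at this
  have n4 : u ∉ N x' := by
    intro hh
    have : x' ∈ N u ∩ S := Finset.mem_inter.2 ⟨hG.symm _ _ hh, f3.2⟩
    rw [h.nu] at this
    simp [h.xpv, h.xpv', h.dx.symm] at this
  have c1 := hG.bip _ _ a1.1
  have c2 := hG.bip _ _ a2.1
  have c3 := hG.bip _ _ a3.1
  have c4 : col v' = col v := by
    have := hG.bip _ _ b1.1
    rw [c1] at this
    simpa using this.symm
  exact Conf.mk' hG (col v)
      (by intro j; fin_cases j
          exacts [rfl, c4, by simp [hG.bip _ _ e3.1, c1], by simp [hG.bip _ _ f3.1, c2]])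
      (by intro j; fin_cases j; exacts [c1, c2, c3, by simp [hG.bip _ _ b3.1, c4]])
      (inj4 h.dv h.xv.symm h.xpv.symm h.xv'.symm h.xpv'.symm h.dx)
      (inj4 h.du h.tu.symm h.tpu.symm h.tu'.symm h.tpu'.symm h.dt)
      (by intro j; fin_cases j; exacts [e1.2, e2.2, e3.2, f3.2])
      (by intro j; fin_cases j; exacts [a1.2, a2.2, a3.2, b3.2])
      (by intro i j
          fin_cases i <;> fin_cases j <;>
            simp [a1.1, a2.1, a3.1, b1.1, b2.1, b3.1, e3', f3', n1, n2, n3, n4, h1, h2, h3, h4])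

/-- Three of the four far adjacencies: better estimate for the main term. -/
theorem Cyc.main3 {v v' u u' t t' x x' : V} (h : Cyc N S v v' u u' t t' x x')
    (hG : BGraph N col) (h3 : ∀ v ∈ S, (N v ∩ S).card = 3)
    (ih : ∀ S' ⊂ S, (pmc N S') ^ 4 ≤ dprod N S') {b : ℝ} (hb : (dprod N S : ℝ) = b ^ 4)
    (hb0 : 0 ≤ b) (h1 : t ∈ N x) (h2 : t' ∉ N x) (h4 : t ∈ N x') (h5 : t' ∈ N x') :
    (pmc N (S \ {v, v', u, u'}) : ℝ) ≤ 2096 / 10000 * b := by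
  have hC := h.conf hG true false true true (by simp [h1]) (by simp [h2]) (by simp [h4])
    (by simp [h5])
  have hdg : ∀ i, (N (Sum.elim ![v, v', x, x'] ![u, u', t, t'] i) ∩ S).card =
      (fun _ => 3 : Fin 4 ⊕ Fin 4 → ℕ) i := fun i => h3 _ (hC.mem i)
  have d1 := hC.dbound hG (fun v hv => (h3 v hv).le) _ hdg (by decide)
    {Sum.inl 0, Sum.inl 1, Sum.inr 0, Sum.inr 1} 4 (by decide) 81 (by decide) (2 / 9) b hb
    (by norm_num)
  have himg : (({Sum.inl 0, Sum.inl 1, Sum.inr 0, Sum.inr 1} : Finset (Fin 4 ⊕ Fin 4)).image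
      (Sum.elim ![v, v', x, x'] ![u, u', t, t'])) = {v, v', u, u'} := by simp
  rw [himg] at d1
  obtain ⟨b', hbp0, hb'⟩ := root4 (dprod N (S \ {v, v', u, u'}))
  rw [hb'] at d1
  have hle : b' ≤ 2 / 9 * b := le_of_pow_le_pow_left₀ (by norm_num) (by positivity) d1
  have mx : x ∈ S := hC.mem (Sum.inl 2)
  have mx' : x' ∈ S := hC.mem (Sum.inl 3)
  have mt : t ∈ S := hC.mem (Sum.inr 2)
  have mt' : t' ∈ S := hC.mem (Sum.inr 3)
  have mu' : u' ∈ S := hC.mem (Sum.inr 1)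
  have mv : v ∈ S := hC.mem (Sum.inl 0)
  have ne : ∀ i j : Fin 4, (Sum.elim ![v, v', x, x'] ![u, u', t, t'] (Sum.inl i)) ≠
      (Sum.elim ![v, v', x, x'] ![u, u', t, t'] (Sum.inr j)) := fun i j hh =>
    by simpa using hC.inj hh
  have xu : x ≠ u := ne 2 0
  have xu' : x ≠ u' := ne 2 1
  have xpu : x' ≠ u := ne 3 0
  have xpu' : x' ≠ u' := ne 3 1
  have vt : v ≠ t := ne 0 2
  have vpt : v' ≠ t := ne 1 2
  have vt' : v ≠ t' := ne 0 3
  have vpt' : v' ≠ t' := ne 1 3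
  have nx' : N x' ∩ S = {u', t, t'} := nb_eq3 (h3 x' mx')
    ((hC.adj (Sum.inl 3) (Sum.inr 1)).2 rfl) mu' h4 mt h5 mt' h.tu'.symm h.tpu'.symm h.dt
  have nt : N t ∩ S = {v, x', x} := nb_eq3 (h3 t mt)
    ((hC.adj (Sum.inr 2) (Sum.inl 0)).2 rfl) mv (hG.symm _ _ h4) mx' (hG.symm _ _ h1) mx
      h.xpv.symm h.xv.symm h.dx.symm
  have hsub : S \ {v, v', u, u'} ⊆ S := Finset.sdiff_subset
  have := low22na (S := S \ {v, v', u, u'}) hG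
    (fun w hw => (Finset.card_le_card (Finset.inter_subset_inter_left hsub)).trans
      (h3 w (hsub hw)).le)
    (fun S' hS' => ih S' (hS'.trans_subset hsub)) hb' hbp0 (v := x') (u := t) (w := t') (x := x)
    (by simp [mx', h.xpv, h.xpv', xpu, xpu']) (by simp [mt, vt.symm, vpt.symm, h.tu, h.tu'])
    (by rw [← Finset.inter_sdiff_assoc, nx']
        ext y
        simp only [Finset.mem_sdiff, Finset.mem_insert, Finset.mem_singleton]
        constructor
        · tauto
        · rintro (rfl | rfl)
          · simp [vt.symm, vpt.symm, h.tu, h.tu']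
          · simp [vt'.symm, vpt'.symm, h.tpu, h.tpu'])
    h.dt
    (by rw [← Finset.inter_sdiff_assoc, nt]
        ext y
        simp only [Finset.mem_sdiff, Finset.mem_insert, Finset.mem_singleton]
        constructor
        · tauto
        · rintro (rfl | rfl)
          · simp [h.xpv, h.xpv', xpu, xpu']
          · simp [h.xv, h.xv', xu, xu'])
    h.dx.symm (fun hh => h2 (hG.symm _ _ hh))
  refine this.trans ?_
  nlinarith

/-- Bound for a middle term. -/
noncomputable def cm (m : Bool) : ℝ := if m then 12832 / 100000 else 10477 / 100000

set_option maxHeartbeats 1000000 in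
theorem Cyc.bound {v v' u u' t t' x x' : V} (h : Cyc N S v v' u u' t t' x x')
    (hG : BGraph N col) (h3 : ∀ v ∈ S, (N v ∩ S).card = 3)
    (ih : ∀ S' ⊂ S, (pmc N S') ^ 4 ≤ dprod N S') {b : ℝ} (hb : (dprod N S : ℝ) = b ^ 4)
    (hb0 : 0 ≤ b) : (pmc N S : ℝ) ≤ b := by
  obtain ⟨m1, h1⟩ := bex (t ∈ N x)
  obtain ⟨m2, h2⟩ := bex (t' ∈ N x)
  obtain ⟨m3, h3'⟩ := bex (t ∈ N x')
  obtain ⟨m4, h4⟩ := bex (t' ∈ N x')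
  have hC := h.conf hG m1 m2 m3 m4 h1 h2 h3' h4
  have hdg : ∀ i, (N (Sum.elim ![v, v', x, x'] ![u, u', t, t'] i) ∩ S).card =
      (fun _ => 3 : Fin 4 ⊕ Fin 4 → ℕ) i := fun i => h3 _ (hC.mem i)
  have hd : ∀ v ∈ S, (N v ∩ S).card ≤ 3 := fun v hv => (h3 v hv).le
  -- expansion
  have e1 := hC.ex3 hG ∅ (Sum.inl 0) (Sum.inr 0) (Sum.inr 1) (Sum.inr 2) {Sum.inl 0, Sum.inr 0}
    {Sum.inl 0, Sum.inr 1} {Sum.inl 0, Sum.inr 2} (by rw [hdg]; rfl) (of_decide_eq_true rfl)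
  have e2 := hC.ex2 hG {Sum.inl 0, Sum.inr 0} (Sum.inl 1) (Sum.inr 1) (Sum.inr 3)
    {Sum.inl 0, Sum.inl 1, Sum.inr 0, Sum.inr 1} {Sum.inl 0, Sum.inl 1, Sum.inr 0, Sum.inr 3}
    (by rw [hdg]; rfl) (of_decide_eq_true rfl)
  have e3 := hC.ex2 hG {Sum.inl 0, Sum.inr 1} (Sum.inl 1) (Sum.inr 0) (Sum.inr 3)
    {Sum.inl 0, Sum.inl 1, Sum.inr 0, Sum.inr 1} {Sum.inl 0, Sum.inl 1, Sum.inr 1, Sum.inr 3}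
    (by rw [hdg]; rfl) (of_decide_eq_true rfl)
  have e4 := hC.ex3 hG {Sum.inl 0, Sum.inr 2} (Sum.inl 1) (Sum.inr 0) (Sum.inr 1) (Sum.inr 3)
    {Sum.inl 0, Sum.inl 1, Sum.inr 0, Sum.inr 2} {Sum.inl 0, Sum.inl 1, Sum.inr 1, Sum.inr 2}
    {Sum.inl 0, Sum.inl 1, Sum.inr 2, Sum.inr 3}
    (by rw [hdg]; rfl) (of_decide_eq_true rfl)
  have e5 := hC.ex1 hG {Sum.inl 0, Sum.inl 1, Sum.inr 0, Sum.inr 3} (Sum.inr 1) (Sum.inl 3)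
    {Sum.inl 0, Sum.inl 1, Sum.inr 0, Sum.inr 1, Sum.inr 3, Sum.inl 3}
    (by rw [hdg]; rfl) (of_decide_eq_true rfl)
  have e6 := hC.ex1 hG {Sum.inl 0, Sum.inl 1, Sum.inr 1, Sum.inr 3} (Sum.inr 0) (Sum.inl 2)
    {Sum.inl 0, Sum.inl 1, Sum.inr 0, Sum.inr 1, Sum.inr 3, Sum.inl 2}
    (by rw [hdg]; rfl) (of_decide_eq_true rfl)
  have e7 := hC.ex1 hG {Sum.inl 0, Sum.inl 1, Sum.inr 0, Sum.inr 2} (Sum.inr 1) (Sum.inl 3)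
    {Sum.inl 0, Sum.inl 1, Sum.inr 0, Sum.inr 1, Sum.inr 2, Sum.inl 3}
    (by rw [hdg]; rfl) (of_decide_eq_true rfl)
  have e8 := hC.ex1 hG {Sum.inl 0, Sum.inl 1, Sum.inr 1, Sum.inr 2} (Sum.inr 0) (Sum.inl 2)
    {Sum.inl 0, Sum.inl 1, Sum.inr 0, Sum.inr 1, Sum.inr 2, Sum.inl 2}
    (by rw [hdg]; rfl) (of_decide_eq_true rfl)
  have e9 := hC.ex1 hG {Sum.inl 0, Sum.inl 1, Sum.inr 2, Sum.inr 3} (Sum.inr 0) (Sum.inl 2)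
    {Sum.inl 0, Sum.inl 1, Sum.inl 2, Sum.inr 0, Sum.inr 2, Sum.inr 3}
    (by rw [hdg]; rfl) (of_decide_eq_true rfl)
  have e10 := hC.ex1 hG {Sum.inl 0, Sum.inl 1, Sum.inl 2, Sum.inr 0, Sum.inr 2, Sum.inr 3}
    (Sum.inr 1) (Sum.inl 3) Finset.univ
    (by rw [hdg]; rfl) (of_decide_eq_true rfl)
  -- bounds
  have hcm : ∀ m : Bool, 0 ≤ cm m ∧ (2 / 3 : ℝ) ^ (if m then 4 else 6) ≤ (cm m) ^ 4 * (729 : ℕ) := by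
    intro m
    cases m <;> norm_num [cm]
  have b0 := hC.pbound hG hd ih _ hdg (by decide) {Sum.inl 0, Sum.inl 1, Sum.inr 0, Sum.inr 1}
    (by simp) 4 (of_decide_eq_true rfl) 81 (by decide) (2 / 9) b hb hb0 (by norm_num) (by norm_num)
  have b1 := hC.pbound hG hd ih _ hdg (by decide)
    {Sum.inl 0, Sum.inl 1, Sum.inr 0, Sum.inr 1, Sum.inr 3, Sum.inl 3}
    (by simp) (if m4 then 4 else 6) (by clear * - m4; revert m1 m2 m3 m4; decide) 729 (by decide)
    (cm m4) b hb hb0 (hcm _).1 (hcm _).2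
  have b2 := hC.pbound hG hd ih _ hdg (by decide)
    {Sum.inl 0, Sum.inl 1, Sum.inr 0, Sum.inr 1, Sum.inr 3, Sum.inl 2}
    (by simp) (if m2 then 4 else 6) (by clear * - m2; revert m1 m2 m3 m4; decide) 729 (by decide)
    (cm m2) b hb hb0 (hcm _).1 (hcm _).2
  have b3 := hC.pbound hG hd ih _ hdg (by decide)
    {Sum.inl 0, Sum.inl 1, Sum.inr 0, Sum.inr 1, Sum.inr 2, Sum.inl 3}
    (by simp) (if m3 then 4 else 6) (by clear * - m3; revert m1 m2 m3 m4; decide) 729 (by decide)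
    (cm m3) b hb hb0 (hcm _).1 (hcm _).2
  have b4 := hC.pbound hG hd ih _ hdg (by decide)
    {Sum.inl 0, Sum.inl 1, Sum.inr 0, Sum.inr 1, Sum.inr 2, Sum.inl 2}
    (by simp) (if m1 then 4 else 6) (by clear * - m1; revert m1 m2 m3 m4; decide) 729 (by decide)
    (cm m1) b hb hb0 (hcm _).1 (hcm _).2
  have b5 : ∀ c : ℝ, 0 ≤ c → (2 / 3 : ℝ) ^ (8 - 2 * (m1.toNat + m2.toNat + m3.toNat + m4.toNat)) ≤
      c ^ 4 * (6561 : ℕ) → _ := fun c => hC.pbound hG hd ih _ hdg (by decide) Finset.univ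
    (by simp) (8 - 2 * (m1.toNat + m2.toNat + m3.toNat + m4.toNat))
    (by clear * - m3; revert m1 m2 m3 m4; decide) 6561 (by decide) c b hb hb0
  have f0 : pq N S (Sum.elim ![v, v', x, x'] ![u, u', t, t'])
    {Sum.inl 0, Sum.inl 1, Sum.inr 0, Sum.inr 1} = pmc N (S \ {v, v', u, u'}) := by simp [pq]
  have hP := pq_empty (N := N) (S := S)
    (f := (Sum.elim ![v, v', x, x'] ![u, u', t, t'] : Fin 4 ⊕ Fin 4 → V))
  rw [← hP, e1, e2, e3, e4, e5, e6, e7, e8, e9, e10]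
  push_cast
  have a3 : (m1.toNat + m2.toNat + m3.toNat + m4.toNat) = 3 →
      (pq N S (Sum.elim ![v, v', x, x'] ![u, u', t, t'])
        {Sum.inl 0, Sum.inl 1, Sum.inr 0, Sum.inr 1} : ℝ) ≤ 2096 / 10000 * b := by
    intro ha
    rw [f0]
    have hcases : (m1 = true ∧ m2 = true ∧ m3 = true ∧ m4 = false) ∨
        (m1 = true ∧ m2 = true ∧ m3 = false ∧ m4 = true) ∨
        (m1 = true ∧ m2 = false ∧ m3 = true ∧ m4 = true) ∨
        (m1 = false ∧ m2 = true ∧ m3 = true ∧ m4 = true) := by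
      clear * - ha
      revert m1 m2 m3 m4
      decide
    have nt : ∀ m : Bool, m = false → ¬ m = true := by decide
    rcases hcases with ⟨n1, n2, n3, n4⟩ | ⟨n1, n2, n3, n4⟩ | ⟨n1, n2, n3, n4⟩ | ⟨n1, n2, n3, n4⟩
    · replace n4 := nt _ n4
      rw [← h1] at n1
      rw [← h2] at n2
      rw [← h3'] at n3
      rw [← h4] at n4
      have := h.swapu.main3 hG h3 ih hb hb0 n3 n4 n1 n2
      rwa [Finset.pair_comm u' u] at this
    · replace n3 := nt _ n3
      rw [← h1] at n1
      rw [← h2] at n2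
      rw [← h3'] at n3
      rw [← h4] at n4
      have := h.swapu.swapv.main3 hG h3 ih hb hb0 n4 n3 n2 n1
      rwa [Finset.pair_comm u' u, Finset.insert_comm v' v] at this
    · replace n2 := nt _ n2
      rw [← h1] at n1
      rw [← h2] at n2
      rw [← h3'] at n3
      rw [← h4] at n4
      exact h.main3 hG h3 ih hb hb0 n1 n2 n3 n4
    · replace n1 := nt _ n1
      rw [← h1] at n1
      rw [← h2] at n2
      rw [← h3'] at n3
      rw [← h4] at n4
      have := h.swapv.main3 hG h3 ih hb hb0 n2 n1 n4 n3
      rwa [Finset.insert_comm v' v] at this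
  by_cases ha : m1.toNat + m2.toNat + m3.toNat + m4.toNat = 4
  · have n : m1 = true ∧ m2 = true ∧ m3 = true ∧ m4 = true := by
      clear * - ha
      revert m1 m2 m3 m4
      decide
    obtain ⟨rfl, rfl, rfl, rfl⟩ := n
    have g1 := hC.ex1 hG {Sum.inl 0, Sum.inl 1, Sum.inr 0, Sum.inr 1, Sum.inr 3, Sum.inl 3}
      (Sum.inr 2) (Sum.inl 2) Finset.univ (by rw [hdg]; rfl) (by decide)
    have g2 := hC.ex1 hG {Sum.inl 0, Sum.inl 1, Sum.inr 0, Sum.inr 1, Sum.inr 3, Sum.inl 2}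
      (Sum.inr 2) (Sum.inl 3) Finset.univ (by rw [hdg]; rfl) (by decide)
    have g3 := hC.ex1 hG {Sum.inl 0, Sum.inl 1, Sum.inr 0, Sum.inr 1, Sum.inr 2, Sum.inl 3}
      (Sum.inr 3) (Sum.inl 2) Finset.univ (by rw [hdg]; rfl) (by decide)
    have g4 := hC.ex1 hG {Sum.inl 0, Sum.inl 1, Sum.inr 0, Sum.inr 1, Sum.inr 2, Sum.inl 2}
      (Sum.inr 3) (Sum.inl 3) Finset.univ (by rw [hdg]; rfl) (by decide)
    have b5' := b5 (1 / 9) (by norm_num) (by norm_num)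
    rw [g1, g2, g3, g4]
    linarith
  by_cases ha3 : m1.toNat + m2.toNat + m3.toNat + m4.toNat = 3
  · have b0' := a3 ha3
    rw [ha3] at b5
    have b5' := b5 (9074 / 100000) (by norm_num) (by norm_num)
    have hs : cm m1 + cm m2 + cm m3 + cm m4 ≤ 4898 / 10000 := by
      revert ha3
      clear * - m1
      cases m1 <;> cases m2 <;> cases m3 <;> cases m4 <;> norm_num [cm]
    nlinarith
  · have b5' := b5 (7409 / 100000) (by norm_num) (by
      have h4 : 4 ≤ 8 - 2 * (m1.toNat + m2.toNat + m3.toNat + m4.toNat) := by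
        clear * - ha ha3
        revert m1 m2 m3 m4
        decide
      exact (pow_le_pow_of_le_one (by norm_num) (by norm_num) h4).trans (by norm_num))
    have hs : cm m1 + cm m2 + cm m3 + cm m4 ≤ 467 / 1000 := by
      revert ha3 ha
      clear * - m1
      cases m1 <;> cases m2 <;> cases m3 <;> cases m4 <;> norm_num [cm]
    nlinarith

end Cycle

section NoCycle

variable {N : V → Finset V} {col : V → Bool} {S : Finset V}

/-- No 4-cycle inside `S`. -/
def No4 (N : V → Finset V) (S : Finset V) : Prop :=
  ∀ v ∈ S, ∀ v' ∈ S, ∀ u ∈ S, ∀ u' ∈ S, v ≠ v' → u ≠ u' → u ∈ N v → u' ∈ N v → u ∈ N v' →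
    u' ∉ N v'

/-- No copy of the 3 by 3 all-ones matrix inside `S`. -/
def J3free (N : V → Finset V) (S : Finset V) : Prop :=
  ∀ a b : Fin 3 → V, Function.Injective a → Function.Injective b → (∀ i, a i ∈ S) →
      (∀ i, b i ∈ S) → ¬ ∀ i j, b j ∈ N (a i)

theorem no4_leaf (hG : BGraph N col) (h3 : ∀ v ∈ S, (N v ∩ S).card = 3) (h4 : No4 N S)
    (ih : ∀ S' ⊂ S, (pmc N S') ^ 4 ≤ dprod N S') {b : ℝ} (hb : (dprod N S : ℝ) = b ^ 4)
    (hb0 : 0 ≤ b) {u v v1 v2 p r c1 : V} (mu : u ∈ S) (mv : v ∈ S) (mv1 : v1 ∈ S) (mv2 : v2 ∈ S)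
    (mp : p ∈ S) (mr : r ∈ S) (mc : c1 ∈ S)
    (a0 : u ∈ N v) (a1 : u ∈ N v1) (a2 : u ∈ N v2) (ap : p ∈ N v1) (ar : r ∈ N v2) (ac : c1 ∈ N v)
    (d1 : v ≠ v1) (d2 : v ≠ v2) (d3 : v1 ≠ v2) (up : u ≠ p) (ur : u ≠ r) (uc : u ≠ c1) :
    (pmc N (S \ {u, v, v1, v2, p, r}) : ℝ) ≤ 81 / 1000 * b := by
  have n1 : p ∉ N v := h4 v1 mv1 v mv u mu p mp d1.symm up a1 ap a0
  have n2 : p ∉ N v2 := h4 v1 mv1 v2 mv2 u mu p mp d3 up a1 ap a2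
  have n3 : r ∉ N v := h4 v2 mv2 v mv u mu r mr d2.symm ur a2 ar a0
  have n4 : r ∉ N v1 := h4 v2 mv2 v1 mv1 u mu r mr d3.symm ur a2 ar a1
  have n5 : c1 ∉ N v1 := h4 v mv v1 mv1 u mu c1 mc d1 uc a0 ac a1
  have n6 : c1 ∉ N v2 := h4 v mv v2 mv2 u mu c1 mc d2 uc a0 ac a2
  have pr : p ≠ r := by rintro rfl; exact n4 ap
  have pc : p ≠ c1 := by rintro rfl; exact n5 ap
  have rc : r ≠ c1 := by rintro rfl; exact n6 ar
  have k0 := hG.bip _ _ a0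
  have k1 : col v1 = col v := by
    have := hG.bip _ _ a1
    rw [k0] at this
    simpa using this.symm
  have k2 : col v2 = col v := by
    have := hG.bip _ _ a2
    rw [k0] at this
    simpa using this.symm
  have kp : col p = !col v := by rw [hG.bip _ _ ap, k1]
  have kr : col r = !col v := by rw [hG.bip _ _ ar, k2]
  have kc := hG.bip _ _ ac
  have hC : Conf N S (tb ![![true, false, false], ![true, true, false], ![true, false, true]])
      (Sum.elim ![v, v1, v2] ![u, p, r]) :=
    Conf.mk' hG (col v)
      (by intro j; fin_cases j; exacts [rfl, k1, k2])
      (by intro j; fin_cases j; exacts [k0, kp, kr])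
      (inj3 d1 d2 d3) (inj3 up ur pr)
      (by intro j; fin_cases j; exacts [mv, mv1, mv2])
      (by intro j; fin_cases j; exacts [mu, mp, mr])
      (by intro i j
          fin_cases i <;> fin_cases j <;> simp [a0, a1, a2, ap, ar, n1, n2, n3, n4])
  have hdg : ∀ i, (N (Sum.elim ![v, v1, v2] ![u, p, r] i) ∩ S).card =
      (fun _ => 3 : Fin 3 ⊕ Fin 3 → ℕ) i := fun i => h3 _ (hC.mem i)
  have dd := hC.dbound hG (fun v hv => (h3 v hv).le) _ hdg (by decide)
    Finset.univ 8 (by decide) 729 (by decide) (856 / 10000) b hb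
    (by norm_num)
  have himg : ((Finset.univ : Finset (Fin 3 ⊕ Fin 3)).image
      (Sum.elim ![v, v1, v2] ![u, p, r])) = {u, v, v1, v2, p, r} := by
    rw [show (Finset.univ : Finset (Fin 3 ⊕ Fin 3)) =
      {Sum.inr 0, Sum.inl 0, Sum.inl 1, Sum.inl 2, Sum.inr 1, Sum.inr 2} by decide]
    simp
  rw [himg] at dd
  obtain ⟨b', hbp0, hb'⟩ := root4 (dprod N (S \ {u, v, v1, v2, p, r}))
  rw [hb'] at dd
  have hle : b' ≤ 856 / 10000 * b := le_of_pow_le_pow_left₀ (by norm_num) (by positivity) dd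
  have hsub : S \ {u, v, v1, v2, p, r} ⊆ S := Finset.sdiff_subset
  have cv : c1 ≠ v := by
    rintro rfl; exact hG.irrefl _ ac
  have cv1 : c1 ≠ v1 := by
    rintro rfl; rw [kc] at k1; cases hh : col v <;> simp [hh] at k1
  have cv2 : c1 ≠ v2 := by
    rintro rfl; rw [kc] at k2; cases hh : col v <;> simp [hh] at k2
  have hcard : (N c1 ∩ (S \ {u, v, v1, v2, p, r})).card = 2 := by
    have e : N c1 ∩ (S \ {u, v, v1, v2, p, r}) = (N c1 ∩ S).erase v := by
      ext y
      simp only [Finset.mem_inter, Finset.mem_sdiff, Finset.mem_insert, Finset.mem_singleton,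
        not_or, Finset.mem_erase]
      constructor
      · tauto
      · rintro ⟨h1, h2, h3⟩
        have ky := hG.bip _ _ h2
        refine ⟨h2, h3, ?_, h1, ?_, ?_, ?_, ?_⟩
        · rintro rfl; rw [k0, kc] at ky; cases hh : col v <;> simp [hh] at ky
        · rintro rfl; exact n5 (hG.symm _ _ h2)
        · rintro rfl; exact n6 (hG.symm _ _ h2)
        · rintro rfl; rw [kp, kc] at ky; cases hh : col v <;> simp [hh] at ky
        · rintro rfl; rw [kr, kc] at ky; cases hh : col v <;> simp [hh] at ky
    rw [e, Finset.card_erase_of_mem (Finset.mem_inter.2 ⟨hG.symm _ _ ac, mv⟩), h3 c1 mc]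
  have := low2 (S := S \ {u, v, v1, v2, p, r}) hG
    (fun w hw => (Finset.card_le_card (Finset.inter_subset_inter_left hsub)).trans
      (h3 w (hsub hw)).le)
    (fun S' hS' => ih S' (hS'.trans_subset hsub)) hb' hbp0 (v := c1)
    (by simp [mc, uc.symm, pc.symm, rc.symm, cv, cv1, cv2]) hcard
  rcases this with h | ⟨_, y, hy, w, hw, hyw, x, hx, hxw, hxc⟩
  · refine h.trans ?_
    nlinarith
  · exfalso
    rw [Finset.mem_inter] at hy hw hx
    exact h4 c1 mc x (hsub hx.2) y (hsub hy.2) w (hsub hw.2) hxc.symm hyw hy.1 hw.1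
      (hG.symm _ _ hx.1) (hG.symm _ _ hxw)

theorem no4_term (hG : BGraph N col) (h3 : ∀ v ∈ S, (N v ∩ S).card = 3) (h4 : No4 N S)
    (ih : ∀ S' ⊂ S, (pmc N S') ^ 4 ≤ dprod N S') {b : ℝ} (hb : (dprod N S : ℝ) = b ^ 4)
    (hb0 : 0 ≤ b) {u v v1 v2 : V} (mu : u ∈ S) (mv : v ∈ S) (mv1 : v1 ∈ S) (mv2 : v2 ∈ S)
    (a0 : u ∈ N v) (a1 : u ∈ N v1) (a2 : u ∈ N v2)
    (d1 : v ≠ v1) (d2 : v ≠ v2) (d3 : v1 ≠ v2) :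
    (pmc N (S \ {u, v}) : ℝ) ≤ 324 / 1000 * b := by
  have two : ∀ w ∈ S, u ∈ N w → ∃ p q, p ≠ u ∧ q ≠ u ∧ p ≠ q ∧ (p ∈ N w ∧ p ∈ S) ∧
      (q ∈ N w ∧ q ∈ S) := by
    intro w mw hw
    have h2 : ((N w ∩ S).erase u).card = 2 := by
      rw [Finset.card_erase_of_mem (Finset.mem_inter.2 ⟨hw, mu⟩), h3 w mw]
    obtain ⟨p, q, hpq, e⟩ := Finset.card_eq_two.1 h2
    have hp : p ∈ (N w ∩ S).erase u := by rw [e]; simp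
    have hq : q ∈ (N w ∩ S).erase u := by rw [e]; simp
    rw [Finset.mem_erase, Finset.mem_inter] at hp hq
    exact ⟨p, q, hp.1, hq.1, hpq, hp.2, hq.2⟩
  obtain ⟨c1, -, hc1, -, -, hc, -⟩ := two v mv a0
  obtain ⟨p, q, pu, qu, hpq, hp, hq⟩ := two v1 mv1 a1
  obtain ⟨r, s, ru, su, hrs, hr, hs⟩ := two v2 mv2 a2
  have n0 : ∀ p, p ≠ u → p ∈ N v1 → p ∈ S → p ∉ N v ∧ p ∉ N v2 := fun p pu hp hp' =>
    ⟨h4 v1 mv1 v mv u mu p hp' d1.symm pu.symm a1 hp a0,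
     h4 v1 mv1 v2 mv2 u mu p hp' d3 pu.symm a1 hp a2⟩
  have n1 : ∀ p, p ≠ u → p ∈ N v2 → p ∈ S → p ∉ N v ∧ p ∉ N v1 := fun p pu hp hp' =>
    ⟨h4 v2 mv2 v mv u mu p hp' d2.symm pu.symm a2 hp a0,
     h4 v2 mv2 v1 mv1 u mu p hp' d3.symm pu.symm a2 hp a1⟩
  have np := n0 p pu hp.1 hp.2
  have nq := n0 q qu hq.1 hq.2
  have nr := n1 r ru hr.1 hr.2
  have ns := n1 s su hs.1 hs.2
  have pr : p ≠ r := by rintro rfl; exact nr.2 hp.1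
  have ps : p ≠ s := by rintro rfl; exact ns.2 hp.1
  have qr : q ≠ r := by rintro rfl; exact nr.2 hq.1
  have qs : q ≠ s := by rintro rfl; exact ns.2 hq.1
  have k0 := hG.bip _ _ a0
  have k1 : col v1 = col v := by
    have := hG.bip _ _ a1
    rw [k0] at this
    simpa using this.symm
  have k2 : col v2 = col v := by
    have := hG.bip _ _ a2
    rw [k0] at this
    simpa using this.symm
  have ib : Function.Injective ![u, p, q, r, s] := by
    intro i j hij
    fin_cases i <;> fin_cases j <;> simp_all [eq_comm]
  have hC : Conf N S (tb ![![true, false, false, false, false], ![true, true, true, false, false],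
        ![true, false, false, true, true]])
      (Sum.elim ![v, v1, v2] ![u, p, q, r, s]) :=
    Conf.mk' hG (col v)
      (by intro j; fin_cases j; exacts [rfl, k1, k2])
      (by intro j; fin_cases j
          exacts [k0, by simp [hG.bip _ _ hp.1, k1], by simp [hG.bip _ _ hq.1, k1],
            by simp [hG.bip _ _ hr.1, k2], by simp [hG.bip _ _ hs.1, k2]])
      (inj3 d1 d2 d3) ib
      (by intro j; fin_cases j; exacts [mv, mv1, mv2])
      (by intro j; fin_cases j; exacts [mu, hp.2, hq.2, hr.2, hs.2])
      (by intro i j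
          fin_cases i <;> fin_cases j <;> simp [a0, a1, a2, hp.1, hq.1, hr.1, hs.1, np, nq, nr, ns])
  have hdg : ∀ i, (N (Sum.elim ![v, v1, v2] ![u, p, q, r, s] i) ∩ S).card =
      (fun _ => 3 : Fin 3 ⊕ Fin 5 → ℕ) i := fun i => h3 _ (hC.mem i)
  have e1 := hC.ex2 hG {Sum.inr 0, Sum.inl 0} (Sum.inl 1) (Sum.inr 1) (Sum.inr 2)
    {Sum.inr 0, Sum.inl 0, Sum.inl 1, Sum.inr 1} {Sum.inr 0, Sum.inl 0, Sum.inl 1, Sum.inr 2}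
    (by rw [hdg]; decide) (by decide)
  have e2 := hC.ex2 hG {Sum.inr 0, Sum.inl 0, Sum.inl 1, Sum.inr 1} (Sum.inl 2) (Sum.inr 3)
    (Sum.inr 4)
    {Sum.inr 0, Sum.inl 0, Sum.inl 1, Sum.inl 2, Sum.inr 1, Sum.inr 3}
    {Sum.inr 0, Sum.inl 0, Sum.inl 1, Sum.inl 2, Sum.inr 1, Sum.inr 4}
    (by rw [hdg]; decide) (by decide)
  have e3 := hC.ex2 hG {Sum.inr 0, Sum.inl 0, Sum.inl 1, Sum.inr 2} (Sum.inl 2) (Sum.inr 3)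
    (Sum.inr 4)
    {Sum.inr 0, Sum.inl 0, Sum.inl 1, Sum.inl 2, Sum.inr 2, Sum.inr 3}
    {Sum.inr 0, Sum.inl 0, Sum.inl 1, Sum.inl 2, Sum.inr 2, Sum.inr 4}
    (by rw [hdg]; decide) (by decide)
  have lf : ∀ p r, p ≠ u → r ≠ u → p ∈ N v1 → r ∈ N v2 → p ∈ S → r ∈ S →
      (pmc N (S \ {u, v, v1, v2, p, r}) : ℝ) ≤ 81 / 1000 * b := by
    intro p r pu ru hp hr mp mr
    exact no4_leaf hG h3 h4 ih hb hb0 mu mv mv1 mv2 mp mr hc.2 a0 a1 a2 hp hr hc.1 d1 d2 d3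
      pu.symm ru.symm hc1.symm
  have l1 := lf p r pu ru hp.1 hr.1 hp.2 hr.2
  have l2 := lf p s pu su hp.1 hs.1 hp.2 hs.2
  have l3 := lf q r qu ru hq.1 hr.1 hq.2 hr.2
  have l4 := lf q s qu su hq.1 hs.1 hq.2 hs.2
  rw [e2, e3] at e1
  simp [pq] at e1
  rw [e1]
  push_cast
  linarith

theorem no4_bound (hG : BGraph N col) (h3 : ∀ v ∈ S, (N v ∩ S).card = 3) (h4 : No4 N S)
    (ih : ∀ S' ⊂ S, (pmc N S') ^ 4 ≤ dprod N S') {b : ℝ} (hb : (dprod N S : ℝ) = b ^ 4)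
    (hb0 : 0 ≤ b) {u : V} (mu : u ∈ S) : (pmc N S : ℝ) ≤ b := by
  obtain ⟨v, v1, v2, d1, d2, d3, e⟩ := Finset.card_eq_three.1 (h3 u mu)
  have a0 := nbS e (u := v) (by simp)
  have a1 := nbS e (u := v1) (by simp)
  have a2 := nbS e (u := v2) (by simp)
  have s0 := hG.symm _ _ a0.1
  have s1 := hG.symm _ _ a1.1
  have s2 := hG.symm _ _ a2.1
  have t0 := no4_term hG h3 h4 ih hb hb0 mu a0.2 a1.2 a2.2 s0 s1 s2 d1 d2 d3
  have t1 := no4_term hG h3 h4 ih hb hb0 mu a1.2 a0.2 a2.2 s1 s0 s2 d1.symm d3 d2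
  have t2 := no4_term hG h3 h4 ih hb hb0 mu a2.2 a0.2 a1.2 s2 s0 s1 d2.symm d3.symm d1
  rw [pmc_expand hG mu, e, Finset.sum_insert (by simp [d1, d2]), Finset.sum_pair d3]
  push_cast
  linarith

/-- A cubic bipartite graph without `K_{3,3}`. -/
theorem cubic_bound (hG : BGraph N col) (h3 : ∀ v ∈ S, (N v ∩ S).card = 3) (hJ : J3free N S)
    (ih : ∀ S' ⊂ S, (pmc N S') ^ 4 ≤ dprod N S') {b : ℝ} (hb : (dprod N S : ℝ) = b ^ 4)
    (hb0 : 0 ≤ b) (hS : S.Nonempty) : (pmc N S : ℝ) ≤ b := by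
  by_cases h4 : No4 N S
  · obtain ⟨u, hu⟩ := hS
    exact no4_bound hG h3 h4 ih hb hb0 hu
  unfold No4 at h4
  push Not at h4
  obtain ⟨v, mv, v', mv', u, mu, u', mu', dv, du, a1, a2, b1, b2⟩ := h4
  obtain ⟨t, tu, tu', et⟩ := nb_three (h3 v mv) a1 mu a2 mu' du
  obtain ⟨t', tpu, tpu', et'⟩ := nb_three (h3 v' mv') b1 mu b2 mu' du
  obtain ⟨x, xv, xv', ex⟩ := nb_three (h3 u mu) (hG.symm _ _ a1) mv (hG.symm _ _ b1) mv' dv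
  obtain ⟨x', xpv, xpv', ex'⟩ := nb_three (h3 u' mu') (hG.symm _ _ a2) mv (hG.symm _ _ b2) mv' dv
  have ht := nbS et (u := t) (by simp)
  have ht' := nbS et' (u := t') (by simp)
  have hx := nbS ex (u := x) (by simp)
  have hx' := nbS ex' (u := x') (by simp)
  by_cases tt : t = t'
  · subst tt
    exact same_support hG h3 ih hb hb0 hJ mv mv' mu mu' ht.2 a1 a2 ht.1 b1 b2 ht'.1 dv du tu.symm
      tu'.symm
  by_cases xx : x = x'
  · subst xx
    exact same_support hG h3 ih hb hb0 hJ mu mu' mv mv' hx.2 (hG.symm _ _ a1) (hG.symm _ _ b1) hx.1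
      (hG.symm _ _ a2) (hG.symm _ _ b2) hx'.1 du dv xv.symm xv'.symm
  exact Cyc.bound ⟨et, et', ex, ex', dv, du, tt, xx, tu, tu', tpu, tpu', xv, xv', xpv, xpv'⟩
    hG h3 ih hb hb0

/-- The key inequality: for subcubic bipartite graphs without `K_{3,3}`, the fourth power of the
number of perfect matchings is at most the product of the degrees. -/
theorem key_ineq (hG : BGraph N col) (S : Finset V) : (∀ v ∈ S, (N v ∩ S).card ≤ 3) →
    J3free N S → (pmc N S) ^ 4 ≤ dprod N S := by
  induction S using Finset.strongInduction with
  | H S IH =>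
  intro hd hJ
  have ih : ∀ S' ⊂ S, (pmc N S') ^ 4 ≤ dprod N S' := by
    intro S' hS'
    refine IH S' hS' (fun v hv => ?_) ?_
    · exact (Finset.card_le_card (Finset.inter_subset_inter_left hS'.1)).trans (hd v (hS'.1 hv))
    · intro a b ia ib ha hb
      exact hJ a b ia ib (fun i => hS'.1 (ha i)) (fun i => hS'.1 (hb i))
  obtain ⟨b, hb0, hb⟩ := root4 (dprod N S)
  suffices h : (pmc N S : ℝ) ≤ b by
    have : (pmc N S : ℝ) ^ 4 ≤ dprod N S := by
      rw [hb]
      exact pow_le_pow_left₀ (Nat.cast_nonneg _) h 4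
    exact_mod_cast this
  by_cases h0 : ∃ v ∈ S, (N v ∩ S).card = 0
  · obtain ⟨v, hv, e⟩ := h0
    rw [pmc_expand hG hv, Finset.card_eq_zero.1 e]
    simpa using hb0
  by_cases h1 : ∃ v ∈ S, (N v ∩ S).card = 1
  · obtain ⟨v, hv, e⟩ := h1
    obtain ⟨u, hu⟩ := Finset.card_eq_one.1 e
    have hu' := nbS hu (u := u) (by simp)
    have := low1 hG hd ih hb hb0 hv hu 1 (by norm_num) (by
      have h1 : 1 ≤ (N u ∩ S).card :=
        Finset.card_pos.2 ⟨v, Finset.mem_inter.2 ⟨hG.symm _ _ hu'.1, hv⟩⟩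
      have h2 := hd u hu'.2
      generalize (N u ∩ S).card = d at *
      interval_cases d <;> norm_num)
    linarith
  by_cases h2 : ∃ v ∈ S, (N v ∩ S).card = 2
  · obtain ⟨v, hv, e⟩ := h2
    rcases low2 hG hd ih hb hb0 hv e with h | h
    · linarith
    · exact h.1
  by_cases hS : S.Nonempty
  · refine cubic_bound hG (fun v hv => ?_) hJ ih hb hb0 hS
    push Not at h0 h1 h2
    have := hd v hv
    have := h0 v hv
    have := h1 v hv
    have := h2 v hv
    omega
  · rw [Finset.not_nonempty_iff_eq_empty] at hS
    subst hS
    rw [pmc_empty]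
    simp only [dprod, Finset.prod_empty, Nat.cast_one] at hb
    rw [Nat.cast_one]
    by_contra hlt
    have : b ^ 4 < 1 := pow_lt_one₀ hb0 (lt_of_not_ge hlt) (by norm_num)
    linarith

end NoCycle

section Structure

variable {N : V → Finset V} {col : V → Bool} {S : Finset V}

/-- Counting matchings of the rows in a list. -/
def cnt {ι : Type} [Fintype ι] [DecidableEq ι] (T : ι → ι → Bool) : List ι → Finset ι → ℕ
  | [], _ => 1
  | i :: L, I => ∑ j ∈ Finset.univ.filter (fun j => T i j = true ∧ j ∉ I),
      cnt T L (insert i (insert j I))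

theorem Conf.count {ι : Type} [Fintype ι] [DecidableEq ι] {T : ι → ι → Bool} {f : ι → V}
    (hG : BGraph N col) (hC : Conf N S T f) (L : List ι) : ∀ (I : Finset ι),
    L.Nodup → (∀ i ∈ L, i ∉ I) → (∀ i ∈ L, ∀ j ∈ L, T i j = false) →
    I.card + 2 * L.length = Fintype.card ι →
    (∀ i ∈ L, (N (f i) ∩ S).card = (Finset.univ.filter fun j => T i j = true).card) →
    pq N S f I = cnt T L I * pq N S f Finset.univ := by
  induction L with
  | nil =>
    intro I _ _ _ hc _
    have : I = Finset.univ := by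
      rw [← Finset.card_eq_iff_eq_univ]
      simpa using hc
    rw [this, cnt, one_mul]
  | cons i L IH =>
    intro I hn hI hT hc hfull
    rw [List.nodup_cons] at hn
    rw [hC.expand hG I i (hI i (by simp)) (hfull i (by simp)), cnt, Finset.sum_mul]
    refine Finset.sum_congr rfl fun j hj => ?_
    simp only [Finset.mem_filter, Finset.mem_univ, true_and] at hj
    have hjL : ∀ i' ∈ i :: L, i' ≠ j := by
      rintro i' hi' rfl
      have := hT i (by simp) i' hi'
      rw [hj.1] at this
      exact absurd this (by simp)
    refine IH _ hn.2 ?_ (fun i hi j hj => hT i (by simp [hi]) j (by simp [hj])) ?_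
      (fun i hi => hfull i (by simp [hi]))
    · intro i' hi'
      simp only [Finset.mem_insert, not_or]
      refine ⟨?_, hjL i' (by simp [hi']), hI i' (by simp [hi'])⟩
      rintro rfl
      exact hn.1 hi'
    · rw [Finset.card_insert_of_notMem, Finset.card_insert_of_notMem hj.2]
      · simp at hc ⊢; omega
      · simp only [Finset.mem_insert, not_or]
        exact ⟨hjL i (by simp), hI i (by simp)⟩

/-- A `K_{3,3}` inside a cubic set. -/
structure K33 (N : V → Finset V) (col : V → Bool) (S : Finset V) (a b : Fin 3 → V) : Prop where
  ia : Function.Injective a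
  ib : Function.Injective b
  ma : ∀ i, a i ∈ S
  mb : ∀ i, b i ∈ S
  ca : ∀ i, col (a i) = true
  cb : ∀ i, col (b i) = false
  adj : ∀ i j, b j ∈ N (a i)

/-- The vertex set of a `K_{3,3}`. -/
def kset (a b : Fin 3 → V) : Finset V := Finset.univ.image (Sum.elim a b)

theorem mem_kset {a b : Fin 3 → V} {y : V} : y ∈ kset a b ↔ (∃ i, a i = y) ∨ ∃ i, b i = y := by
  simp [kset]

theorem K33.conf {a b : Fin 3 → V} (h : K33 N col S a b) (hG : BGraph N col) :
    Conf N S (tb fun _ _ => true) (Sum.elim a b) :=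
  Conf.mk' hG true h.ca (by simpa using h.cb) h.ia h.ib h.ma h.mb (by simpa using h.adj)

theorem K33.pmc {a b : Fin 3 → V} (h : K33 N col S a b) (hG : BGraph N col)
    (h3 : ∀ v ∈ S, (N v ∩ S).card = 3) : pmc N S = 6 * pmc N (S \ kset a b) := by
  have hC := h.conf hG
  have := hC.count hG [Sum.inl 0, Sum.inl 1, Sum.inl 2] ∅ (by decide) (by decide) (by decide)
    (by decide) (by intro i hi; rw [h3 _ (hC.mem i)]; revert i; decide)
  rw [pq_empty] at this
  rw [this, show cnt _ _ _ = 6 by decide]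
  rfl

theorem K33.closed {a b : Fin 3 → V} (h : K33 N col S a b) (hG : BGraph N col)
    (h3 : ∀ v ∈ S, (N v ∩ S).card = 3) : ∀ x ∈ kset a b, ∀ y ∈ S, y ∈ N x → y ∈ kset a b := by
  have key : ∀ (x : V) (c : Fin 3 → V), x ∈ S → Function.Injective c → (∀ i, c i ∈ S) →
      (∀ i, c i ∈ N x) → ∀ y ∈ S, y ∈ N x → ∃ i, c i = y := by
    intro x c hx ic mc ac y hy hyx
    have e : Finset.univ.image c = N x ∩ S := by
      apply Finset.eq_of_subset_of_card_le
      · intro z hz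
        obtain ⟨i, _, rfl⟩ := Finset.mem_image.1 hz
        exact Finset.mem_inter.2 ⟨ac i, mc i⟩
      · rw [h3 x hx, Finset.card_image_of_injective _ ic]
        simp
    have : y ∈ Finset.univ.image c := by
      rw [e]; exact Finset.mem_inter.2 ⟨hyx, hy⟩
    simpa using this
  intro x hx y hy hyx
  rw [mem_kset] at hx ⊢
  rcases hx with ⟨i, rfl⟩ | ⟨i, rfl⟩
  · exact Or.inr (key _ b (h.ma i) h.ib h.mb (h.adj i) y hy hyx)
  · exact Or.inl (key _ a (h.mb i) h.ia h.ma (fun j => hG.symm _ _ (h.adj j i)) y hy hyx)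

theorem K33.cubic {a b : Fin 3 → V} (h : K33 N col S a b) (hG : BGraph N col)
    (h3 : ∀ v ∈ S, (N v ∩ S).card = 3) :
    ∀ v ∈ S \ kset a b, (N v ∩ (S \ kset a b)).card = 3 := by
  intro v hv
  rw [Finset.mem_sdiff] at hv
  rw [← h3 v hv.1]
  congr 1
  ext y
  simp only [Finset.mem_inter, Finset.mem_sdiff]
  constructor
  · tauto
  · rintro ⟨h1, h2⟩
    refine ⟨h1, h2, fun hy => hv.2 ?_⟩
    exact h.closed hG h3 y hy v hv.1 (hG.symm _ _ h1)

theorem K33.counts {a b : Fin 3 → V} (h : K33 N col S a b) (c : Bool) (m : ℕ)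
    (hm : (S.filter fun v => col v = c).card = m + 3) :
    ((S \ kset a b).filter fun v => col v = c).card = m := by
  have key : ∀ d : Fin 3 → V, Function.Injective d → (∀ i, d i ∈ S) → (∀ i, col (d i) = c) →
      (∀ y, col y = c → (y ∈ kset a b ↔ ∃ i, d i = y)) →
      ((S \ kset a b).filter fun v => col v = c).card = m := by
    intro d id md cd hk
    have e : ((S \ kset a b).filter fun v => col v = c) =
        (S.filter fun v => col v = c) \ Finset.univ.image d := by
      ext y
      simp only [Finset.mem_filter, Finset.mem_sdiff, Finset.mem_image, Finset.mem_univ, true_and]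
      constructor
      · rintro ⟨⟨h1, h2⟩, h3⟩
        exact ⟨⟨h1, h3⟩, by rwa [hk y h3] at h2⟩
      · rintro ⟨⟨h1, h2⟩, h3⟩
        exact ⟨⟨h1, by rwa [hk y h2]⟩, h2⟩
    rw [e, Finset.card_sdiff_of_subset, hm, Finset.card_image_of_injective _ id]
    · simp
    · intro y hy
      obtain ⟨i, _, rfl⟩ := Finset.mem_image.1 hy
      simp [md, cd]
  cases c
  · refine key b h.ib h.mb h.cb fun y hy => ?_
    rw [mem_kset]
    constructor
    · rintro (⟨i, rfl⟩ | h')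
      · rw [h.ca] at hy; exact absurd hy (by simp)
      · exact h'
    · exact Or.inr
  · refine key a h.ia h.ma h.ca fun y hy => ?_
    rw [mem_kset]
    constructor
    · rintro (h' | ⟨i, rfl⟩)
      · exact h'
      · rw [h.cb] at hy; exact absurd hy (by simp)
    · exact Or.inl

/-- The target pattern. -/
def pat (i j : ℕ) : Prop := (i < 4 ∧ j < 4 ∧ i ≠ j) ∨ (4 ≤ i ∧ 4 ≤ j ∧ (i - 4) / 3 = (j - 4) / 3)

instance (i j : ℕ) : Decidable (pat i j) := by unfold pat; infer_instance

/-- `S` carries the target pattern. -/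
structure Pat (N : V → Finset V) (col : V → Bool) (S : Finset V) (k : ℕ) (r c : ℕ → V) : Prop where
  rm : ∀ i < 4 + 3 * k, r i ∈ S ∧ col (r i) = true
  cm : ∀ i < 4 + 3 * k, c i ∈ S ∧ col (c i) = false
  ri : ∀ i < 4 + 3 * k, ∀ j < 4 + 3 * k, r i = r j → i = j
  ci : ∀ i < 4 + 3 * k, ∀ j < 4 + 3 * k, c i = c j → i = j
  adj : ∀ i < 4 + 3 * k, ∀ j < 4 + 3 * k, (c j ∈ N (r i) ↔ pat i j)

/-- `S` is cubic with `4 + 3k` rows and columns. -/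
structure Cub (N : V → Finset V) (col : V → Bool) (S : Finset V) (k : ℕ) : Prop where
  deg : ∀ v ∈ S, (N v ∩ S).card = 3
  cnt : ∀ c, (S.filter fun v => col v = c).card = 4 + 3 * k

theorem Cub.card {k : ℕ} (h : Cub N col S k) : S.card = 8 + 6 * k := by
  have h1 := h.cnt true
  have h2 := h.cnt false
  have h3 := Finset.card_filter_add_card_filter_not (s := S) (fun v => col v = true)
  simp only [Bool.not_eq_true] at h3
  omega

theorem K33.cub {a b : Fin 3 → V} {k : ℕ} (h : K33 N col S a b) (hG : BGraph N col)
    (hS : Cub N col S (k + 1)) : Cub N col (S \ kset a b) k :=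
  ⟨h.cubic hG hS.deg, fun c => h.counts c _ (by rw [hS.cnt c]; ring)⟩

theorem Pat.count (hG : BGraph N col) (k : ℕ) : ∀ (S : Finset V) (r c : ℕ → V), Cub N col S k →
    Pat N col S k r c → pmc N S = 9 * 6 ^ k := by
  induction k with
  | zero =>
    intro S r c hS hP
    have hC : Conf N S (tb fun i j : Fin 4 => decide (i ≠ j))
        (Sum.elim (fun i : Fin 4 => r i) (fun i : Fin 4 => c i)) := by
      refine Conf.mk' hG true (fun i => (hP.rm i (by omega)).2)
        (by simpa using fun i : Fin 4 => (hP.cm i (by omega)).2)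
        ?_ ?_ (fun i => (hP.rm i (by omega)).1) (fun i => (hP.cm i (by omega)).1) ?_
      · intro i j h; exact Fin.ext (hP.ri i (by omega) j (by omega) h)
      · intro i j h; exact Fin.ext (hP.ci i (by omega) j (by omega) h)
      · intro i j
        rw [hP.adj i (by omega) j (by omega)]
        simp only [pat, decide_eq_true_eq, ne_eq, Fin.ext_iff]
        omega
    have := hC.count hG [Sum.inl 0, Sum.inl 1, Sum.inl 2, Sum.inl 3] ∅ (by decide) (by decide)
      (by decide) (by decide) (by intro i hi; rw [hS.deg _ (hC.mem i)]; revert i; decide)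
    rw [pq_empty, show cnt _ _ _ = 9 by decide] at this
    have e : Finset.univ.image
        (Sum.elim (fun i : Fin 4 => r i) (fun i : Fin 4 => c i)) = S := by
      apply Finset.eq_of_subset_of_card_le
      · intro z hz
        obtain ⟨i, _, rfl⟩ := Finset.mem_image.1 hz
        exact hC.mem i
      · rw [hS.card, Finset.card_image_of_injective _ hC.inj]
        simp
    rw [this, pq, e]
    simp [pmc_empty]
  | succ k ih =>
    intro S r c hS hP
    have hK : K33 N col S (fun i => r (4 + 3 * k + i)) (fun i => c (4 + 3 * k + i)) := by
      refine ⟨?_, ?_, fun i => (hP.rm _ (by omega)).1, fun i => (hP.cm _ (by omega)).1,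
        fun i => (hP.rm _ (by omega)).2, fun i => (hP.cm _ (by omega)).2, fun i j => ?_⟩
      · intro i j h
        have := hP.ri _ (by omega) _ (by omega) h
        exact Fin.ext (by omega)
      · intro i j h
        have := hP.ci _ (by omega) _ (by omega) h
        exact Fin.ext (by omega)
      · rw [hP.adj _ (by omega) _ (by omega)]
        unfold pat
        omega
    rw [hK.pmc hG hS.deg, ih _ r c (hK.cub hG hS), pow_succ]
    · ring
    · refine ⟨fun i hi => ?_, fun i hi => ?_, fun i hi j hj => hP.ri i (by omega) j (by omega),
        fun i hi j hj => hP.ci i (by omega) j (by omega),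
        fun i hi j hj => hP.adj i (by omega) j (by omega)⟩
      · have h1 := hP.rm i (by omega)
        refine ⟨Finset.mem_sdiff.2 ⟨h1.1, ?_⟩, h1.2⟩
        rw [mem_kset]
        rintro (⟨j, h⟩ | ⟨j, h⟩)
        · have := hP.ri _ (by omega) _ (by omega) h
          omega
        · have := (hP.cm (4 + 3 * k + j) (by omega)).2
          rw [h, h1.2] at this
          exact absurd this (by simp)
      · have h1 := hP.cm i (by omega)
        refine ⟨Finset.mem_sdiff.2 ⟨h1.1, ?_⟩, h1.2⟩
        rw [mem_kset]
        rintro (⟨j, h⟩ | ⟨j, h⟩)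
        · have := (hP.rm (4 + 3 * k + j) (by omega)).2
          rw [h, h1.2] at this
          exact absurd this (by simp)
        · have := hP.ci _ (by omega) _ (by omega) h
          omega

theorem K33.of_not_free (hG : BGraph N col) (h : ¬ J3free N S) : ∃ a b, K33 N col S a b := by
  unfold J3free at h
  push Not at h
  obtain ⟨a, b, ia, ib, ma, mb, adj⟩ := h
  have c1 : ∀ j, col (b j) = !col (a 0) := fun j => hG.bip _ _ (adj 0 j)
  have c2 : ∀ i, col (a i) = !col (b 0) := fun i => hG.bip _ _ (hG.symm _ _ (adj i 0))
  cases hc : col (a 0)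
  · refine ⟨b, a, ib, ia, mb, ma, fun i => ?_, fun i => ?_, fun i j => hG.symm _ _ (adj j i)⟩
    · rw [c1, hc]; rfl
    · rw [c2, c1, hc]; rfl
  · refine ⟨a, b, ia, ib, ma, mb, fun i => ?_, fun i => ?_, adj⟩
    · rw [c2, c1, hc]; rfl
    · rw [c1, hc]; rfl

theorem Cub.base (hG : BGraph N col) (hS : Cub N col S 0) : ∃ r c, Pat N col S 0 r c := by
  have sub : ∀ v ∈ S, ∀ b, col v = !b → N v ∩ S ⊆ S.filter fun w => col w = b := by
    intro v _ b hb y hy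
    rw [Finset.mem_inter] at hy
    have := hG.bip _ _ hy.1
    rw [hb] at this
    simp [hy.2, this]
  have miss : ∀ v, ∃ w, v ∈ S → col v = true →
      (w ∈ S ∧ col w = false ∧ ∀ y ∈ S, col y = false → (y ∈ N v ↔ y ≠ w)) := by
    intro v
    by_cases hv : v ∈ S ∧ col v = true
    · have h1 := sub v hv.1 false (by simp [hv.2])
      have h2 : ((S.filter fun w => col w = false) \ (N v ∩ S)).card = 1 := by
        rw [Finset.card_sdiff_of_subset h1, hS.cnt, hS.deg v hv.1]
      obtain ⟨w, hw⟩ := Finset.card_eq_one.1 h2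
      have hw' : w ∈ (S.filter fun w => col w = false) \ (N v ∩ S) := by rw [hw]; simp
      simp only [Finset.mem_sdiff, Finset.mem_filter, Finset.mem_inter] at hw'
      refine ⟨w, fun _ _ => ⟨hw'.1.1, hw'.1.2, fun y hy hy' => ?_⟩⟩
      constructor
      · rintro h rfl
        exact hw'.2 ⟨h, hy⟩
      · intro hne
        by_contra hn
        have : y ∈ (S.filter fun w => col w = false) \ (N v ∩ S) := by
          simp [hy, hy', hn]
        rw [hw] at this
        exact hne (by simpa using this)
    · exact ⟨v, fun h h' => absurd ⟨h, h'⟩ hv⟩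
  choose g hg using miss
  have ginj : ∀ v ∈ S, ∀ v' ∈ S, col v = true → col v' = true → g v = g v' → v = v' := by
    intro v hv v' hv' cv cv' e
    by_contra hne
    obtain ⟨w1, w2, w3⟩ := hg v hv cv
    obtain ⟨w1', w2', w3'⟩ := hg v' hv' cv'
    have n1 : v ∉ N (g v) := fun h => (w3 _ w1 w2).1 (hG.symm _ _ h) rfl
    have n2 : v' ∉ N (g v) := fun h => (w3' _ w1 w2).1 (hG.symm _ _ h) e
    have hs : N (g v) ∩ S ⊆ (S.filter fun w => col w = true) \ {v, v'} := by
      intro y hy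
      have h1 := sub (g v) w1 true (by simp [w2]) hy
      rw [Finset.mem_inter] at hy
      rw [Finset.mem_sdiff]
      refine ⟨h1, ?_⟩
      simp only [Finset.mem_insert, Finset.mem_singleton, not_or]
      constructor
      · rintro rfl; exact n1 hy.1
      · rintro rfl; exact n2 hy.1
    have h2 := Finset.card_le_card hs
    rw [hS.deg _ w1, Finset.card_sdiff_of_subset, hS.cnt, Finset.card_pair hne] at h2
    · omega
    · intro y hy
      simp only [Finset.mem_insert, Finset.mem_singleton] at hy
      rcases hy with rfl | rfl <;> simp [*]
  have hR := hS.cnt true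
  let e := (Finset.equivFinOfCardEq hR).symm
  have he : ∀ i, (e i : V) ∈ S ∧ col (e i : V) = true := fun i => by
    exact Finset.mem_filter.1 (e i).2
  let r : ℕ → V := fun i => if h : i < 4 + 3 * 0 then (e ⟨i, h⟩ : V) else g (e ⟨0, by omega⟩)
  have hr : ∀ i (h : i < 4 + 3 * 0), r i = e ⟨i, h⟩ := fun i h => by simp only [r]; rw [dif_pos h]
  have hrm : ∀ i < 4 + 3 * 0, r i ∈ S ∧ col (r i) = true := fun i h => by
    rw [hr i h]; exact he _
  have hri : ∀ i < 4 + 3 * 0, ∀ j < 4 + 3 * 0, r i = r j → i = j := by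
    intro i hi j hj h
    rw [hr i hi, hr j hj] at h
    have := e.injective (Subtype.ext h)
    simpa using this
  have hci : ∀ i < 4 + 3 * 0, ∀ j < 4 + 3 * 0, g (r i) = g (r j) → i = j := by
    intro i hi j hj h
    exact hri i hi j hj
      (ginj _ (hrm i hi).1 _ (hrm j hj).1 (hrm i hi).2 (hrm j hj).2 h)
  have hcm : ∀ i < 4 + 3 * 0, g (r i) ∈ S ∧ col (g (r i)) = false := by
    intro i hi
    have := hg _ (hrm i hi).1 (hrm i hi).2
    exact ⟨this.1, this.2.1⟩
  refine ⟨r, fun i => g (r i), hrm, hcm, hri, hci, ?_⟩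
  intro i hi j hj
  rw [(hg _ (hrm i hi).1 (hrm i hi).2).2.2 _ (hcm j hj).1 (hcm j hj).2]
  have : g (r j) ≠ g (r i) ↔ i ≠ j := by
    rw [not_iff_not]
    constructor
    · intro h; exact (hci j hj i hi h).symm
    · rintro rfl; rfl
  rw [this]
  unfold pat
  omega

theorem Cub.main (hG : BGraph N col) (k : ℕ) : ∀ S : Finset V, Cub N col S k →
    pmc N S ≤ 9 * 6 ^ k ∧ (pmc N S = 9 * 6 ^ k → ∃ r c, Pat N col S k r c) := by
  induction k with
  | zero =>
    intro S hS
    refine ⟨?_, fun _ => hS.base hG⟩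
    by_cases hJ : J3free N S
    · have := key_ineq hG S (fun v hv => (hS.deg v hv).le) hJ
      rw [dprod, Finset.prod_congr rfl hS.deg, Finset.prod_const, hS.card] at this
      have h2 : (pmc N S) ^ 4 ≤ 9 ^ 4 := this.trans (by norm_num)
      simpa using (Nat.pow_le_pow_iff_left (by norm_num)).1 h2
    · obtain ⟨r, c, hP⟩ := hS.base hG
      exact (hP.count hG 0 S r c hS).le
  | succ k ih =>
    intro S hS
    by_cases hJ : J3free N S
    · have h1 := key_ineq hG S (fun v hv => (hS.deg v hv).le) hJ
      rw [dprod, Finset.prod_congr rfl hS.deg, Finset.prod_const, hS.card] at h1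
      have h2 : (pmc N S) ^ 4 < (9 * 6 ^ (k + 1)) ^ 4 := by
        refine lt_of_le_of_lt h1 ?_
        have e1 : 3 ^ (8 + 6 * (k + 1)) = 6561 * 729 ^ (k + 1) := by
          rw [pow_add, pow_mul]; norm_num
        have e2 : (9 * 6 ^ (k + 1)) ^ 4 = 6561 * 1296 ^ (k + 1) := by
          rw [mul_pow, ← pow_mul, mul_comm (k + 1) 4, pow_mul]; norm_num
        rw [e1, e2]
        have : 729 ^ (k + 1) < 1296 ^ (k + 1) := Nat.pow_lt_pow_left (by norm_num) (by omega)
        omega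
      have h3 := lt_of_pow_lt_pow_left₀ 4 (by positivity) h2
      exact ⟨h3.le, fun h => absurd h h3.ne⟩
    · obtain ⟨a, b, hK⟩ := K33.of_not_free hG hJ
      have hS' := hK.cub hG hS
      obtain ⟨i1, i2⟩ := ih _ hS'
      have hp := hK.pmc hG hS.deg
      refine ⟨by rw [hp, pow_succ]; omega, fun he => ?_⟩
      obtain ⟨r, c, hP⟩ := i2 (by rw [hp, pow_succ] at he; omega)
      have hk : ∀ i < 4 + 3 * k, r i ∉ kset a b ∧ c i ∉ kset a b := fun i hi =>
        ⟨(Finset.mem_sdiff.1 (hP.rm i hi).1).2, (Finset.mem_sdiff.1 (hP.cm i hi).1).2⟩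
      have hs : ∀ i < 4 + 3 * k, r i ∈ S ∧ c i ∈ S := fun i hi =>
        ⟨(Finset.mem_sdiff.1 (hP.rm i hi).1).1, (Finset.mem_sdiff.1 (hP.cm i hi).1).1⟩
      have ka : ∀ i, a i ∈ kset a b := fun i => mem_kset.2 (Or.inl ⟨i, rfl⟩)
      have kb : ∀ i, b i ∈ kset a b := fun i => mem_kset.2 (Or.inr ⟨i, rfl⟩)
      have hcl := hK.closed hG hS.deg
      let ix : ℕ → Fin 3 := fun i => ⟨(i - (4 + 3 * k)) % 3, Nat.mod_lt _ (by norm_num)⟩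
      have hix : ∀ i j, 4 + 3 * k ≤ i → i < 4 + 3 * (k + 1) → 4 + 3 * k ≤ j →
          j < 4 + 3 * (k + 1) → ix i = ix j → i = j := by
        intro i j h1 h2 h3 h4 h
        have := congrArg Fin.val h
        simp only [ix] at this
        omega
      refine ⟨fun i => if i < 4 + 3 * k then r i else a (ix i),
        fun i => if i < 4 + 3 * k then c i else b (ix i), ?_, ?_, ?_, ?_, ?_⟩
      · intro i hi
        split_ifs with h
        · exact ⟨(hs i h).1, (hP.rm i h).2⟩
        · exact ⟨hK.ma _, hK.ca _⟩
      · intro i hi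
        split_ifs with h
        · exact ⟨(hs i h).2, (hP.cm i h).2⟩
        · exact ⟨hK.mb _, hK.cb _⟩
      · intro i hi j hj
        split_ifs with h h' h'
        · exact hP.ri i h j h'
        · intro e; exact absurd (e ▸ ka _) (hk i h).1
        · intro e; exact absurd (e ▸ ka _) (hk j h').1
        · intro e; exact hix i j (by omega) hi (by omega) hj (hK.ia e)
      · intro i hi j hj
        split_ifs with h h' h'
        · exact hP.ci i h j h'
        · intro e; exact absurd (e ▸ kb _) (hk i h).2
        · intro e; exact absurd (e ▸ kb _) (hk j h').2
        · intro e; exact hix i j (by omega) hi (by omega) hj (hK.ib e)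
      · intro i hi j hj
        split_ifs with h h' h'
        · exact hP.adj i h j h'
        · refine iff_of_false (fun hh => ?_) (by unfold pat; omega)
          exact (hk i h).1 (hcl _ (kb _) _ (hs i h).1 (hG.symm _ _ hh))
        · refine iff_of_false (fun hh => ?_) (by unfold pat; omega)
          exact (hk j h').2 (hcl _ (ka _) _ (hs j h').2 hh)
        · exact iff_of_true (hK.adj _ _) (by unfold pat; omega)

end Structure

end Match

section Final

open Finset

/-- Neighbourhoods in the bipartite graph of a matrix. -/
def NA {n : ℕ} (A : Matrix (Fin n) (Fin n) ℕ) (v : Fin n ⊕ Fin n) : Finset (Fin n ⊕ Fin n) :=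
  Finset.univ.filter fun w => tb (fun i j => decide (A i j = 1)) v w = true

theorem NA_lr {n : ℕ} (A : Matrix (Fin n) (Fin n) ℕ) (i j : Fin n) :
    Sum.inr j ∈ NA A (Sum.inl i) ↔ A i j = 1 := by
  rw [NA, Finset.mem_filter]; simp [tb]

theorem NA_rl {n : ℕ} (A : Matrix (Fin n) (Fin n) ℕ) (i j : Fin n) :
    Sum.inl i ∈ NA A (Sum.inr j) ↔ A i j = 1 := by
  rw [NA, Finset.mem_filter]; simp [tb]

theorem NA_ll {n : ℕ} (A : Matrix (Fin n) (Fin n) ℕ) (i j : Fin n) :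
    Sum.inl j ∉ NA A (Sum.inl i) := by
  rw [NA, Finset.mem_filter]; simp [tb]

theorem NA_rr {n : ℕ} (A : Matrix (Fin n) (Fin n) ℕ) (i j : Fin n) :
    Sum.inr j ∉ NA A (Sum.inr i) := by
  rw [NA, Finset.mem_filter]; simp [tb]

theorem NA_graph {n : ℕ} (A : Matrix (Fin n) (Fin n) ℕ) : BGraph (NA A) Sum.isLeft := by
  constructor
  · rintro (i | i) (j | j) h
    · exact absurd h (NA_ll _ _ _)
    · exact (NA_lr _ _ _).2 ((NA_rl _ _ _).1 h)
    · exact (NA_rl _ _ _).2 ((NA_lr _ _ _).1 h)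
    · exact absurd h (NA_rr _ _ _)
  · rintro (i | i) (j | j) h
    · exact absurd h (NA_ll _ _ _)
    · rfl
    · rfl
    · exact absurd h (NA_rr _ _ _)

/-- The involution of a permutation. -/
def dbl {n : ℕ} (φ : Equiv.Perm (Fin n)) : Equiv.Perm (Fin n ⊕ Fin n) where
  toFun := Sum.elim (fun i => Sum.inr (φ i)) (fun j => Sum.inl (φ.symm j))
  invFun := Sum.elim (fun i => Sum.inr (φ i)) (fun j => Sum.inl (φ.symm j))
  left_inv := by rintro (i | i) <;> simp
  right_inv := by rintro (i | i) <;> simp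

theorem perm_eq_pmc {n : ℕ} (A : Matrix (Fin n) (Fin n) ℕ) (hA : IsZeroOne A) :
    perm A = pmc (NA A) Finset.univ := by
  have h1 : ∀ φ : Equiv.Perm (Fin n), ∏ i, A i (φ i) = if ∀ i, A i (φ i) = 1 then 1 else 0 := by
    intro φ
    split_ifs with h
    · exact Finset.prod_eq_one fun i _ => h i
    · push Not at h
      obtain ⟨i, hi⟩ := h
      exact Finset.prod_eq_zero (Finset.mem_univ i) ((hA i (φ i)).resolve_right hi)
  rw [perm, Finset.sum_congr rfl fun φ _ => h1 φ, ← Finset.card_filter, pmc]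
  refine Finset.card_bij (fun φ _ => dbl φ) ?_ ?_ ?_
  · intro φ hφ
    simp only [Finset.mem_filter, Finset.mem_univ, true_and] at hφ ⊢
    refine ⟨(dbl φ).left_inv, ?_, fun v hv => absurd trivial hv⟩
    rintro (i | j) -
    · exact (NA_lr A i (φ i)).2 (hφ i)
    · refine (NA_rl A (φ.symm j) j).2 ?_
      simpa using hφ (φ.symm j)
  · intro φ _ ψ _ h
    ext i
    have := congrArg (fun σ => σ (Sum.inl i)) h
    have h2 : (Sum.inr (φ i) : Fin n ⊕ Fin n) = Sum.inr (ψ i) := this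
    rw [Sum.inr.inj h2]
  · intro σ hσ
    simp only [Finset.mem_filter, Finset.mem_univ, true_and] at hσ
    obtain ⟨hi, hn, -⟩ := hσ
    have hl : ∀ i : Fin n, ∃ j, σ (Sum.inl i) = Sum.inr j := by
      intro i
      have := hn (Sum.inl i) trivial
      cases h : σ (Sum.inl i) with
      | inl k => rw [h] at this; exact absurd this (NA_ll _ _ _)
      | inr k => exact ⟨k, rfl⟩
    have hr : ∀ i : Fin n, ∃ j, σ (Sum.inr i) = Sum.inl j := by
      intro i
      have := hn (Sum.inr i) trivial
      cases h : σ (Sum.inr i) with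
      | inl k => exact ⟨k, rfl⟩
      | inr k => rw [h] at this; exact absurd this (NA_rr _ _ _)
    choose f hf using hl
    choose g hg using hr
    have gf : ∀ i, g (f i) = i := fun i => by
      have := hi (Sum.inl i)
      rw [hf, hg] at this
      exact Sum.inl.inj this
    have fg : ∀ i, f (g i) = i := fun i => by
      have := hi (Sum.inr i)
      rw [hg, hf] at this
      exact Sum.inr.inj this
    refine ⟨⟨f, g, gf, fg⟩, ?_, ?_⟩
    · simp only [Finset.mem_filter, Finset.mem_univ, true_and]
      intro i
      have := hn (Sum.inl i) trivial
      rw [hf] at this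
      exact (NA_lr _ _ _).1 this
    · ext v : 1
      rcases v with i | i
      · exact (hf i).symm
      · exact (hg i).symm

theorem card_ones {n : ℕ} (f : Fin n → ℕ) (hf : ∀ i, f i = 0 ∨ f i = 1) :
    (Finset.univ.filter fun i => f i = 1).card = ∑ i, f i := by
  rw [Finset.card_filter]
  refine Finset.sum_congr rfl fun i _ => ?_
  rcases hf i with h | h <;> simp [h]

theorem NA_cub {k : ℕ} (A : Matrix (Fin (4 + 3 * k)) (Fin (4 + 3 * k)) ℕ)
    (hA : A ∈ Aclass (4 + 3 * k) 3) : Cub (NA A) Sum.isLeft Finset.univ k := by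
  obtain ⟨h01, hr, hc⟩ := hA
  constructor
  · rintro (i | j) -
    · rw [Finset.inter_univ]
      refine Eq.trans (Eq.symm ?_) ((card_ones _ (h01 i)).trans (hr i))
      refine Finset.card_bij (fun j _ => Sum.inr j) ?_ ?_ ?_
      · intro j hj; exact (NA_lr _ _ _).2 (Finset.mem_filter.1 hj).2
      · intro a _ b _ h; exact Sum.inr.inj h
      · rintro (b | b) hb
        · exact absurd hb (NA_ll _ _ _)
        · exact ⟨b, Finset.mem_filter.2 ⟨Finset.mem_univ _, (NA_lr _ _ _).1 hb⟩, rfl⟩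
    · rw [Finset.inter_univ]
      refine Eq.trans (Eq.symm ?_) ((card_ones _ (fun i => h01 i j)).trans (hc j))
      refine Finset.card_bij (fun j _ => Sum.inl j) ?_ ?_ ?_
      · intro j hj; exact (NA_rl _ _ _).2 (Finset.mem_filter.1 hj).2
      · intro a _ b _ h; exact Sum.inl.inj h
      · rintro (b | b) hb
        · exact ⟨b, Finset.mem_filter.2 ⟨Finset.mem_univ _, (NA_rl _ _ _).1 hb⟩, rfl⟩
        · exact absurd hb (NA_rr _ _ _)
  · intro c
    rw [Finset.card_filter, Fintype.sum_sum_type]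
    cases c <;> simp

theorem blockIdx_three (k : ℕ) : ∀ i < 3 * k, blockIdx (List.replicate k 3) i = i / 3 := by
  induction k with
  | zero => intro i hi; omega
  | succ k ih =>
    intro i hi
    rw [List.replicate_succ, blockIdx]
    split_ifs with h
    · omega
    · rw [ih _ (by omega)]; omega

/-- The target matrix. -/
theorem target_apply (k : ℕ) (i j : Fin (4 + 3 * k)) :
    headBlocks (4 + 3 * k) J4mI4 (List.replicate k 3) i j = if pat i j then 1 else 0 := by
  have hi := i.2
  have hj := j.2
  simp only [headBlocks, Matrix.of_apply]
  split_ifs with h1 h2 h2 h2 h2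
  · simp only [J4mI4, Matrix.of_apply, Fin.mk.injEq]
    unfold pat at h2
    rw [if_neg (by omega)]
  · simp only [J4mI4, Matrix.of_apply, Fin.mk.injEq]
    unfold pat at h2
    rw [if_pos (by omega)]
  · rfl
  · rename_i h3
    rw [blockIdx_three k _ (by omega), blockIdx_three k _ (by omega)] at h3
    exact absurd (Or.inr h3) h2
  · rename_i h3
    exfalso
    unfold pat at h2
    rcases h2 with h2 | h2
    · omega
    · apply h3
      refine ⟨h2.1, h2.2.1, ?_⟩
      rw [blockIdx_three k _ (by omega), blockIdx_three k _ (by omega)]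
      exact h2.2.2
  · rfl

theorem pat_symm {i j : ℕ} : pat i j ↔ pat j i := by unfold pat; omega

theorem pat_sum (i : ℕ) (k : ℕ) : ∑ j ∈ Finset.range (4 + 3 * k), (if pat i j then 1 else 0) =
    if i < 4 + 3 * k then 3 else 0 := by
  induction k with
  | zero =>
    simp only [Finset.sum_range_succ, Finset.sum_range_zero, Nat.mul_zero, Nat.add_zero]
    by_cases h : i < 4
    · interval_cases i <;> rfl
    · have h0 : ∀ j < 4, ¬ pat i j := fun j hj => by unfold pat; omega
      rw [if_neg (h0 0 (by omega)), if_neg (h0 1 (by omega)), if_neg (h0 2 (by omega)),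
        if_neg (h0 3 (by omega)), if_neg h]
  | succ k ih =>
    have e : 4 + 3 * (k + 1) = 4 + 3 * k + 1 + 1 + 1 := by ring
    rw [e, Finset.sum_range_succ, Finset.sum_range_succ, Finset.sum_range_succ, ih]
    by_cases h : i < 4 + 3 * k
    · have h0 : ∀ j < 3, ¬ pat i (4 + 3 * k + j) := fun j hj => by unfold pat; omega
      rw [if_pos h, if_neg (by simpa using h0 0 (by omega)), if_neg (h0 1 (by omega)), if_neg (h0 2 (by omega)),
        if_pos (by omega)]
    · by_cases h' : i < 4 + 3 * k + 1 + 1 + 1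
      · have h0 : ∀ j < 3, pat i (4 + 3 * k + j) := fun j hj => by unfold pat; omega
        rw [if_neg h, if_pos (by simpa using h0 0 (by omega)), if_pos (h0 1 (by omega)),
          if_pos (h0 2 (by omega)), if_pos (by omega)]
      · have h0 : ∀ j < 3, ¬ pat i (4 + 3 * k + j) := fun j hj => by unfold pat; omega
        rw [if_neg h, if_neg (by simpa using h0 0 (by omega)), if_neg (h0 1 (by omega)),
          if_neg (h0 2 (by omega)), if_neg (by omega)]

theorem target_mem (k : ℕ) :
    headBlocks (4 + 3 * k) J4mI4 (List.replicate k 3) ∈ Aclass (4 + 3 * k) 3 := by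
  have key : ∀ i : Fin (4 + 3 * k),
      ∑ j, headBlocks (4 + 3 * k) J4mI4 (List.replicate k 3) i j = 3 := by
    intro i
    rw [Finset.sum_congr rfl fun j _ => target_apply k i j,
      Fin.sum_univ_eq_sum_range (fun j => if pat i j then 1 else 0), pat_sum, if_pos i.2]
  refine ⟨?_, key, ?_⟩
  · intro i j
    rw [target_apply]
    split_ifs
    · exact Or.inr rfl
    · exact Or.inl rfl
  · intro j
    refine Eq.trans (Finset.sum_congr rfl fun i _ => ?_) (key j)
    rw [target_apply, target_apply]
    simp only [pat_symm (i := i) (j := j)]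

theorem target_perm (k : ℕ) :
    perm (headBlocks (4 + 3 * k) J4mI4 (List.replicate k 3)) = 9 * 6 ^ k := by
  have hT := target_mem k
  rw [perm_eq_pmc _ hT.1]
  have hlt : ∀ i, i < 4 + 3 * k → i % (4 + 3 * k) = i := fun i h => Nat.mod_eq_of_lt h
  refine Pat.count (NA_graph _) k _
    (fun i => Sum.inl ⟨i % (4 + 3 * k), Nat.mod_lt _ (by omega)⟩)
    (fun i => Sum.inr ⟨i % (4 + 3 * k), Nat.mod_lt _ (by omega)⟩) (NA_cub _ hT)
    ⟨fun i hi => ⟨Finset.mem_univ _, rfl⟩, fun i hi => ⟨Finset.mem_univ _, rfl⟩, ?_, ?_, ?_⟩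
  · intro i hi j hj h
    have := congrArg Fin.val (Sum.inl.inj h)
    simpa only [hlt i hi, hlt j hj] using this
  · intro i hi j hj h
    have := congrArg Fin.val (Sum.inr.inj h)
    simpa only [hlt i hi, hlt j hj] using this
  · intro i hi j hj
    rw [NA_lr, target_apply]
    simp only [hlt i hi, hlt j hj]
    split_ifs with h <;> simp [h]

theorem paq {n : ℕ} (A P Q : Matrix (Fin n) (Fin n) ℕ) (e f : Equiv.Perm (Fin n))
    (hP : ∀ i j, P i j = if j = e i then 1 else 0) (hQ : ∀ i j, Q i j = if j = f i then 1 else 0)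
    (i j : Fin n) : (P * A * Q) i j = A (e i) (f.symm j) := by
  rw [Matrix.mul_apply, Finset.sum_eq_single (f.symm j), hQ, if_pos (by simp), mul_one,
    Matrix.mul_apply, Finset.sum_eq_single (e i), hP, if_pos rfl, one_mul]
  · intro b _ hb; rw [hP, if_neg hb, zero_mul]
  · intro h; exact absurd (Finset.mem_univ _) h
  · intro b _ hb
    rw [hQ, if_neg, mul_zero]
    intro h; apply hb; rw [h]; simp
  · intro h; exact absurd (Finset.mem_univ _) h

theorem perm_reindex {n : ℕ} (A B : Matrix (Fin n) (Fin n) ℕ) (e f : Equiv.Perm (Fin n))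
    (h : ∀ i j, B i j = A (e i) (f j)) : perm B = perm A := by
  unfold perm
  simp only [h]
  refine Fintype.sum_equiv ((Equiv.mulLeft f).trans (Equiv.mulRight e⁻¹)) _ _ fun φ => ?_
  refine Fintype.prod_equiv e _ _ fun i => ?_
  simp

theorem final (k : ℕ) (A : Matrix (Fin (4 + 3 * k)) (Fin (4 + 3 * k)) ℕ)
    (hA : A ∈ Aclass (4 + 3 * k) 3) :
    (∀ B ∈ Aclass (4 + 3 * k) 3, perm B ≤ perm A) ↔
      ∃ P Q, IsPermMatrix P ∧ IsPermMatrix Q ∧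
        P * A * Q = headBlocks (4 + 3 * k) J4mI4 (List.replicate k 3) := by
  have bound : ∀ B ∈ Aclass (4 + 3 * k) 3, perm B ≤ 9 * 6 ^ k := fun B hB => by
    rw [perm_eq_pmc _ hB.1]
    exact (Cub.main (NA_graph B) k _ (NA_cub B hB)).1
  constructor
  · intro h
    have h1 := h _ (target_mem k)
    rw [target_perm] at h1
    have h2 := le_antisymm (bound A hA) h1
    rw [perm_eq_pmc _ hA.1] at h2
    obtain ⟨r, c, hP⟩ := (Cub.main (NA_graph A) k _ (NA_cub A hA)).2 h2
    have hl : ∀ i : Fin (4 + 3 * k), ∃ j, r i = Sum.inl j := fun i =>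
      Sum.isLeft_iff.1 (hP.rm i i.2).2
    have hr : ∀ i : Fin (4 + 3 * k), ∃ j, c i = Sum.inr j := fun i => by
      have := (hP.cm i i.2).2
      exact Sum.isRight_iff.1 (by simpa using this)
    choose f hf using hl
    choose g hg using hr
    have fi : Function.Injective f := fun a b hab => by
      refine Fin.ext (hP.ri a a.2 b b.2 ?_)
      rw [hf, hf, hab]
    have gi : Function.Injective g := fun a b hab => by
      refine Fin.ext (hP.ci a a.2 b b.2 ?_)
      rw [hg, hg, hab]
    let e1 := Equiv.ofBijective f (Finite.injective_iff_bijective.1 fi)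
    let e2 := Equiv.ofBijective g (Finite.injective_iff_bijective.1 gi)
    refine ⟨Matrix.of fun i j => if j = e1 i then 1 else 0,
      Matrix.of fun i j => if j = e2.symm i then 1 else 0,
      ⟨e1, fun _ _ => rfl⟩, ⟨e2.symm, fun _ _ => rfl⟩, ?_⟩
    ext i j
    refine (paq A _ _ e1 e2.symm (fun _ _ => rfl) (fun _ _ => rfl) i j).trans ?_
    rw [target_apply]
    have := hP.adj i i.2 j j.2
    rw [hf, hg, NA_lr] at this
    change A (f i) (g j) = _
    split_ifs with hp
    · exact this.2 hp
    · exact (hA.1 _ _).resolve_right fun h' => hp (this.1 h')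
  · rintro ⟨P, Q, ⟨e, he⟩, ⟨f, hf⟩, h⟩ B hB
    have h1 := perm_reindex A (P * A * Q) e f.symm (paq A P Q e f he hf)
    rw [h, target_perm] at h1
    rw [← h1]
    exact bound B hB

end Final

theorem stmt17 (n : ℕ) (hn : 4 ≤ n) (hmod : n % 3 = 1)
    (A : Matrix (Fin n) (Fin n) ℕ) (hA : A ∈ Aclass n 3) :
    (∀ B ∈ Aclass n 3, perm B ≤ perm A) ↔
      ∃ P Q, IsPermMatrix P ∧ IsPermMatrix Q ∧
        P * A * Q = headBlocks n J4mI4 (List.replicate ((n - 4) / 3) 3) := by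
  obtain ⟨k, rfl⟩ : ∃ k, n = 4 + 3 * k := ⟨(n - 4) / 3, by omega⟩
  have hk : (4 + 3 * k - 4) / 3 = k := by omega
  rw [hk]
  exact final k A hA

end BGM
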